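/- Let n ≥ 2 and let F be an odd-linear-dependency-agreeing family of subsets of Z_2^n \ {0}. Then μ(F) ≤ 1/8, with equality if and only if F is a Schur junta. Moreover, there exists an absolute constant c > 0 such that for every ε > 0, every n ≥ 2, and every odd-linear-dependency-agreeing family F of subsets of Z_2^n \ {0} with μ(F) ≥ 1/8 − ε, there exists a Schur junta T with μ(F Δ T) ≤ c·ε. -/

import Mathlib

/-- A family of subsets of `Z_2^n \ {0}` is odd-linear-dependency-agreeing if,
for any two members `S, T`, there are an odd number of distinct nonzero vectors,
all avoiding the symmetric difference `S Δ T`, which sum to zero. -/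
def OddLDAgreeing (n : ℕ) (F : Finset (Finset (Fin n → ZMod 2))) : Prop :=
  ∀ S ∈ F, ∀ T ∈ F, ∃ (l : ℕ) (v : Fin (2 * l + 1) → (Fin n → ZMod 2)),
    Function.Injective v ∧ (∀ i, v i ≠ 0) ∧
    (∀ i, v i ∉ (S \ T) ∪ (T \ S)) ∧ ∑ i, v i = 0

/-- The uniform measure of a family of subsets of `Z_2^n \ {0}`. -/
noncomputable def muFam (n : ℕ) (F : Finset (Finset (Fin n → ZMod 2))) : ℝ :=
  (F.card : ℝ) / 2 ^ (2 ^ n - 1)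

/-- `F` is a Schur junta: the family of all subsets of `Z_2^n \ {0}` with a
prescribed intersection `R` with a fixed Schur triple `{x, y, x + y}`. -/
def SchurJunta (n : ℕ) (F : Finset (Finset (Fin n → ZMod 2))) : Prop :=
  ∃ (x y : Fin n → ZMod 2) (R : Finset (Fin n → ZMod 2)),
    x ≠ 0 ∧ y ≠ 0 ∧ x ≠ y ∧ x + y ≠ 0 ∧
    R ⊆ ({x, y, x + y} : Finset (Fin n → ZMod 2)) ∧
    F = ((Finset.univ : Finset (Fin n → ZMod 2)).erase 0).powerset.filter
      (fun S => S ∩ ({x, y, x + y} : Finset (Fin n → ZMod 2)) = R)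

section

open Finset
open scoped BigOperators symmDiff

lemma expect_sq_mul_sq_le {ι : Type*} [Fintype ι] (f g : ι → ℝ) :
    (𝔼 x, f x ^ 2 * g x ^ 2) ^ 2 ≤ (𝔼 x, f x ^ 4) * 𝔼 x, g x ^ 4 := by
  simp only [Fintype.expect_eq_sum_div_card]
  rw [div_pow, div_mul_div_comm, ← sq]
  gcongr
  have := sum_mul_sq_le_sq_mul_sq univ (fun x => f x ^ 2) (fun x => g x ^ 2)
  simpa [← pow_mul] using this

section Walsh

variable {α : Type*} [DecidableEq α]

/-- The Walsh character indexed by `R`, evaluated at `S`. -/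
def walsh (R S : Finset α) : ℝ := (-1) ^ #(R ∩ S)

lemma walsh_comm (R S : Finset α) : walsh R S = walsh S R := by
  rw [walsh, walsh, inter_comm]

lemma walsh_eq_prod (R S : Finset α) : walsh R S = ∏ i ∈ R, if i ∈ S then (-1 : ℝ) else 1 := by
  rw [prod_ite, prod_const_one, mul_one, prod_const, filter_mem_eq_inter, walsh]

lemma walsh_symmDiff (R S T : Finset α) : walsh R (S ∆ T) = walsh R S * walsh R T := by
  rw [walsh_eq_prod, walsh_eq_prod, walsh_eq_prod, ← prod_mul_distrib]
  refine prod_congr rfl fun i _ => ?_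
  by_cases hS : i ∈ S <;> by_cases hT : i ∈ T <;> simp [mem_symmDiff, hS, hT]

@[simp] lemma walsh_empty_left (S : Finset α) : walsh ∅ S = 1 := by simp [walsh]

@[simp] lemma walsh_empty_right (S : Finset α) : walsh S ∅ = 1 := by simp [walsh]

lemma walsh_mul_self (R S : Finset α) : walsh R S * walsh R S = 1 := by
  rw [walsh, ← mul_pow]; norm_num

lemma walsh_eq_one_or (R S : Finset α) : walsh R S = 1 ∨ walsh R S = -1 :=
  neg_one_pow_eq_or ℝ _

lemma abs_walsh (R S : Finset α) : |walsh R S| = 1 := by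
  rcases walsh_eq_one_or R S with h | h <;> simp [h]

lemma sum_powerset_walsh_mul_walsh (A R J : Finset α) :
    ∑ B ∈ J.powerset, walsh A B * walsh R B = if R ∩ J = A ∩ J then 2 ^ #J else 0 := by
  have h : ∀ B, walsh A B * walsh R B
      = ∏ i ∈ B, ((if i ∈ A then (-1 : ℝ) else 1) * if i ∈ R then (-1 : ℝ) else 1) := by
    intro B
    rw [walsh_comm A, walsh_comm R, walsh_eq_prod, walsh_eq_prod, prod_mul_distrib]
  simp_rw [h]
  rw [← prod_one_add]
  split_ifs with hRA
  · rw [← prod_const]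
    refine prod_congr rfl fun i hi => ?_
    have : i ∈ R ↔ i ∈ A := by
      have := congrArg (i ∈ ·) hRA
      simpa [hi] using this
    by_cases hA : i ∈ A
    · simp [hA, this.2 hA]; norm_num
    · simp [hA, mt this.1 hA]; norm_num
  · obtain ⟨i, hi⟩ : ∃ i, ¬ (i ∈ R ∩ J ↔ i ∈ A ∩ J) := by
      by_contra! hcon
      exact hRA (Finset.ext hcon)
    have hiJ : i ∈ J := by
      by_contra hJ
      simp [hJ] at hi
    refine prod_eq_zero hiJ ?_
    by_cases hA : i ∈ A <;> by_cases hR : i ∈ R <;> simp_all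

/-- The Walsh polynomial with coefficients `c` on the subsets of `K`. -/
noncomputable def walshPoly (K : Finset α) (c : Finset α → ℝ) (S : Finset α) : ℝ :=
  ∑ R ∈ K.powerset, c R * walsh R S

lemma walshPoly_insert {i : α} {K : Finset α} (hi : i ∉ K) (c : Finset α → ℝ) (S : Finset α) :
    walshPoly (insert i K) c S = walshPoly K c S
      + (if i ∈ S then -1 else 1) * walshPoly K (fun R => c (insert i R)) S := by
  unfold walshPoly
  rw [sum_powerset_insert hi, mul_sum]
  congr 1
  refine sum_congr rfl fun R hR => ?_
  have hiR : i ∉ R := fun h => hi (mem_powerset.1 hR h)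
  rw [walsh_eq_prod (insert i R), prod_insert hiR, ← walsh_eq_prod]
  ring

lemma walshPoly_symmDiff_singleton {i : α} {K : Finset α} (hi : i ∉ K) (c : Finset α → ℝ)
    (S : Finset α) : walshPoly K c (S ∆ {i}) = walshPoly K c S := by
  unfold walshPoly
  refine sum_congr rfl fun R hR => ?_
  have hiR : i ∉ R := fun h => hi (mem_powerset.1 hR h)
  rw [walsh_symmDiff, walsh_eq_prod R {i}]
  have : ∏ j ∈ R, (if j ∈ ({i} : Finset α) then (-1 : ℝ) else 1) = 1 := by
    refine prod_eq_one fun j hj => ?_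
    have : j ≠ i := fun h => hiR (h ▸ hj)
    simp [this]
  rw [this, mul_one]

variable [Fintype α]

/-- The Walsh–Fourier coefficient of `f` at `R`. -/
noncomputable def walshCoeff (f : Finset α → ℝ) (R : Finset α) : ℝ := 𝔼 S, f S * walsh R S

lemma sum_walsh_mul_walsh (A R : Finset α) :
    ∑ B, walsh A B * walsh R B = if R = A then (2 : ℝ) ^ Fintype.card α else 0 := by
  have := sum_powerset_walsh_mul_walsh A R univ
  simpa using this

lemma expect_walsh_mul_walsh (A R : Finset α) :
    𝔼 B, walsh A B * walsh R B = if R = A then (1 : ℝ) else 0 := by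
  rw [Fintype.expect_eq_sum_div_card, sum_walsh_mul_walsh, Fintype.card_finset]
  split_ifs <;> simp

lemma sum_walshCoeff_mul_walsh (f : Finset α → ℝ) (S : Finset α) :
    ∑ R, walshCoeff f R * walsh R S = f S := by
  simp only [walshCoeff, Fintype.expect_eq_sum_div_card, Fintype.card_finset]
  simp_rw [div_mul_eq_mul_div, sum_mul]
  rw [← sum_div, sum_comm]
  have : ∀ T : Finset α, ∑ R, f T * walsh R T * walsh R S
      = f T * if S = T then (2 : ℝ) ^ Fintype.card α else 0 := by
    intro T
    rw [← sum_walsh_mul_walsh, mul_sum]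
    refine sum_congr rfl fun R _ => ?_
    rw [walsh_comm R T, walsh_comm R S, mul_assoc]
  simp_rw [this]
  simp

lemma expect_mul_eq_sum_walshCoeff (f g : Finset α → ℝ) :
    𝔼 S, f S * g S = ∑ R, walshCoeff f R * walshCoeff g R := by
  have : ∀ S, f S * g S = ∑ R, walshCoeff f R * (g S * walsh R S) := by
    intro S
    rw [← sum_walshCoeff_mul_walsh f S, sum_mul]
    exact sum_congr rfl fun R _ => by ring
  simp_rw [this]
  rw [expect_sum_comm]
  exact sum_congr rfl fun R _ => by rw [← mul_expect]; rfl

lemma walshCoeff_sum_mul_walsh (c : Finset α → ℝ) (R : Finset α) :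
    walshCoeff (fun S => ∑ T, c T * walsh T S) R = c R := by
  unfold walshCoeff
  simp_rw [sum_mul]
  rw [expect_sum_comm]
  have : ∀ T, 𝔼 S, c T * walsh T S * walsh R S = if R = T then c T else 0 := by
    intro T
    simp_rw [mul_assoc]
    rw [← mul_expect, expect_walsh_mul_walsh]
    simp
  simp_rw [this]
  simp

lemma expect_comp_symmDiff (f : Finset α → ℝ) (B : Finset α) :
    𝔼 S, f (S ∆ B) = 𝔼 S, f S :=
  Fintype.expect_bijective (· ∆ B)
    (Function.Involutive.bijective fun S => symmDiff_symmDiff_cancel_right B S) _ _ fun _ => rfl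

lemma walshCoeff_comp_symmDiff (f : Finset α → ℝ) (B R : Finset α) :
    walshCoeff (fun S => f (S ∆ B)) R = walsh R B * walshCoeff f R := by
  unfold walshCoeff
  rw [mul_expect, ← expect_comp_symmDiff (fun S => walsh R B * (f S * walsh R S)) B]
  refine expect_congr rfl fun S _ => ?_
  rw [walsh_symmDiff]
  linear_combination (-f (S ∆ B) * walsh R S) * walsh_mul_self R B

/-- The part of `f` whose Walsh expansion meets `J` exactly in `A`. -/
noncomputable def walshPart (J A : Finset α) (f : Finset α → ℝ) (S : Finset α) : ℝ :=
  (∑ B ∈ J.powerset, walsh A B * f (S ∆ B)) / 2 ^ #J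

lemma walshCoeff_walshPart (J A : Finset α) (f : Finset α → ℝ) (R : Finset α) :
    walshCoeff (walshPart J A f) R = if R ∩ J = A ∩ J then walshCoeff f R else 0 := by
  have : walshCoeff (walshPart J A f) R
      = (∑ B ∈ J.powerset, walsh A B * walshCoeff (fun S => f (S ∆ B)) R) / 2 ^ #J := by
    simp only [walshCoeff, walshPart, div_mul_eq_mul_div, sum_mul]
    rw [← expect_div, expect_sum_comm]
    simp_rw [mul_expect, mul_assoc]
  rw [this]
  simp_rw [walshCoeff_comp_symmDiff, ← mul_assoc]
  rw [← sum_mul, sum_powerset_walsh_mul_walsh]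
  split_ifs <;> simp

/-- The Bonami lemma: the fourth moment of a Walsh polynomial of degree at most `d`. -/
lemma expect_walshPoly_pow_four_le (K : Finset α) (d : ℕ) (c : Finset α → ℝ)
    (hc : ∀ R, d < #R → c R = 0) :
    𝔼 S, walshPoly K c S ^ 4 ≤ 9 ^ d * (∑ R ∈ K.powerset, c R ^ 2) ^ 2 := by
  induction K using Finset.induction generalizing d c with
  | empty =>
    simp only [walshPoly, powerset_empty, sum_singleton, walsh_empty_left, mul_one]
    rw [Fintype.expect_const, ← pow_mul]
    exact le_mul_of_one_le_left (by positivity) (one_le_pow₀ (by norm_num))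
  | insert i K hi ih =>
    set q := walshPoly K (fun R => c (insert i R)) with hq
    set r := walshPoly K c with hr
    have hsplit : 𝔼 S, walshPoly (insert i K) c S ^ 4
        = 𝔼 S, r S ^ 4 + 6 * 𝔼 S, q S ^ 2 * r S ^ 2 + 𝔼 S, q S ^ 4 := by
      have h1 : 𝔼 S, walshPoly (insert i K) c S ^ 4
          = 𝔼 S, (walshPoly (insert i K) c S ^ 4
            + walshPoly (insert i K) c (S ∆ {i}) ^ 4) / 2 := by
        rw [← expect_div, expect_add_distrib,
          expect_comp_symmDiff (fun S => walshPoly (insert i K) c S ^ 4)]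
        ring
      rw [h1, mul_expect, ← expect_add_distrib, ← expect_add_distrib]
      refine expect_congr rfl fun S _ => ?_
      rw [walshPoly_insert hi, walshPoly_insert hi, walshPoly_symmDiff_singleton hi,
        walshPoly_symmDiff_singleton hi]
      by_cases hS : i ∈ S <;> simp [hS, mem_symmDiff, ← hq, ← hr] <;> ring
    have hsum : ∑ R ∈ (insert i K).powerset, c R ^ 2
        = ∑ R ∈ K.powerset, c R ^ 2 + ∑ R ∈ K.powerset, c (insert i R) ^ 2 :=
      sum_powerset_insert hi _
    rw [hsplit, hsum]
    set a := ∑ R ∈ K.powerset, c R ^ 2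
    set b := ∑ R ∈ K.powerset, c (insert i R) ^ 2
    have ha : 0 ≤ a := sum_nonneg fun _ _ => sq_nonneg _
    have hb : 0 ≤ b := sum_nonneg fun _ _ => sq_nonneg _
    have hr4 : 𝔼 S, r S ^ 4 ≤ 9 ^ d * a ^ 2 := ih d c hc
    rcases d with _ | d
    · have hq0 : ∀ S, q S = 0 := fun S => sum_eq_zero fun R _ => by
        simp only
        rw [hc _ (card_pos.2 (insert_nonempty i R)), zero_mul]
      simp only [hq0]
      simp only [pow_zero, one_mul] at hr4 ⊢
      norm_num
      nlinarith
    · have hq4 : 𝔼 S, q S ^ 4 ≤ 9 ^ d * b ^ 2 := by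
        have hdeg : ∀ R, d < #R → (if i ∈ R then 0 else c (insert i R)) = 0 := by
          intro R hR
          split_ifs with h
          · rfl
          · exact hc _ (by rw [card_insert_of_notMem h]; omega)
        have := ih d _ hdeg
        have hK : ∀ R ∈ K.powerset, (if i ∈ R then 0 else c (insert i R)) = c (insert i R) :=
          fun R hR => if_neg fun h => hi (mem_powerset.1 hR h)
        have hq' : walshPoly K (fun R => if i ∈ R then 0 else c (insert i R)) = q :=
          funext fun S => sum_congr rfl fun R hR => by simp only [hK R hR]
        rwa [hq', sum_congr rfl fun R hR => by rw [hK R hR]] at this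
      have hqr : 𝔼 S, q S ^ 2 * r S ^ 2 ≤ 3 * 9 ^ d * (a * b) := by
        refine abs_le_of_sq_le_sq' ?_ (by positivity) |>.2
        calc _ ≤ (𝔼 S, q S ^ 4) * 𝔼 S, r S ^ 4 := expect_sq_mul_sq_le _ _
          _ ≤ (9 ^ d * b ^ 2) * (9 ^ (d + 1) * a ^ 2) := by
            gcongr
          _ = _ := by ring
      have h9 : (0 : ℝ) < 9 ^ d := by positivity
      rw [pow_succ] at hr4 ⊢
      have hab : 0 ≤ 9 ^ d * b ^ 2 := by positivity
      nlinarith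

end Walsh

section Cuts

variable {n : ℕ}

/-- The set of vectors which do not lie in the hyperplane orthogonal to `w`. -/
def cut (w : Fin n → ZMod 2) : Finset (Fin n → ZMod 2) := {v | w ⬝ᵥ v = 1}

/-- The additive character of `Z_2^n` attached to `w`. -/
def dotSign (w v : Fin n → ZMod 2) : ℝ := if v ∈ cut w then -1 else 1

lemma mem_cut {w v : Fin n → ZMod 2} : v ∈ cut w ↔ w ⬝ᵥ v = 1 := by simp [cut]

lemma zmod_two_add_eq_one_iff (a b : ZMod 2) : a + b = 1 ↔ ¬ (a = 1 ↔ b = 1) := by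
  revert a b; decide

@[simp] lemma dotSign_zero (w : Fin n → ZMod 2) : dotSign w 0 = 1 := by simp [dotSign, mem_cut]

lemma dotSign_add (w u v : Fin n → ZMod 2) :
    dotSign w (u + v) = dotSign w u * dotSign w v := by
  simp only [dotSign, mem_cut, dotProduct_add, zmod_two_add_eq_one_iff]
  by_cases hu : w ⬝ᵥ u = 1 <;> by_cases hv : w ⬝ᵥ v = 1 <;> simp [hu, hv]

lemma dotSign_sum (w : Fin n → ZMod 2) (R : Finset (Fin n → ZMod 2)) :
    dotSign w (∑ v ∈ R, v) = ∏ v ∈ R, dotSign w v := by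
  induction R using Finset.induction with
  | empty => simp
  | insert v R hv ih => rw [sum_insert hv, prod_insert hv, dotSign_add, ih]

lemma dotSign_sum_eq_neg_one_pow (w : Fin n → ZMod 2) (R : Finset (Fin n → ZMod 2)) :
    dotSign w (∑ v ∈ R, v) = (-1) ^ #(R ∩ cut w) := by
  rw [dotSign_sum, ← walsh, walsh_eq_prod]; rfl

lemma dotSign_mul_self (w v : Fin n → ZMod 2) : dotSign w v * dotSign w v = 1 := by
  unfold dotSign; split_ifs <;> norm_num

lemma dotSign_comm (w v : Fin n → ZMod 2) : dotSign w v = dotSign v w := by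
  simp only [dotSign, mem_cut, dotProduct_comm]

lemma exists_mem_cut {v : Fin n → ZMod 2} (hv : v ≠ 0) : ∃ w, v ∈ cut w := by
  obtain ⟨i, hi⟩ := Function.ne_iff.1 hv
  refine ⟨Pi.single i 1, mem_cut.2 ?_⟩
  rw [single_one_dotProduct]
  have h : ∀ a : ZMod 2, a ≠ 0 → a = 1 := by decide
  exact h _ hi

lemma expect_dotSign (v : Fin n → ZMod 2) : 𝔼 w, dotSign w v = if v = 0 then (1 : ℝ) else 0 := by
  split_ifs with hv
  · simp [hv]
  · obtain ⟨u, hu⟩ := exists_mem_cut hv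
    have h : 𝔼 w, dotSign w v = 𝔼 w, dotSign (w + u) v :=
      (Fintype.expect_equiv (Equiv.addRight u) (fun w => dotSign (w + u) v)
        (fun w => dotSign w v) fun _ => rfl).symm
    have h2 : ∀ w, dotSign (w + u) v = - dotSign w v := by
      intro w
      rw [dotSign_comm, dotSign_add, dotSign_comm v u, dotSign_comm v w]
      simp [dotSign, hu]
    simp_rw [h2, expect_neg_distrib] at h
    linarith

/-- The sum of the signs of the elements of `R`. -/
def signSum (R : Finset (Fin n → ZMod 2)) (w : Fin n → ZMod 2) : ℝ := ∑ v ∈ R, dotSign w v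

lemma signSum_eq (R : Finset (Fin n → ZMod 2)) (w : Fin n → ZMod 2) :
    signSum R w = #R - 2 * #(R ∩ cut w) := by
  have h : ∀ v, dotSign w v = 1 - 2 * if v ∈ cut w then (1 : ℝ) else 0 := by
    intro v; unfold dotSign; split_ifs <;> norm_num
  simp only [signSum, h, sum_sub_distrib, ← mul_sum, sum_boole, filter_mem_eq_inter]
  simp

lemma add_self_eq_zero' (v : Fin n → ZMod 2) : v + v = 0 :=
  funext fun i => CharTwo.add_self_eq_zero (v i)

lemma add_eq_zero_iff_eq' {u v : Fin n → ZMod 2} : u + v = 0 ↔ u = v := by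
  refine ⟨fun h => ?_, fun h => by rw [h, add_self_eq_zero']⟩
  rw [← add_left_inj v, h, add_self_eq_zero']

lemma expect_signSum {R : Finset (Fin n → ZMod 2)} (hR : 0 ∉ R) : 𝔼 w, signSum R w = 0 := by
  unfold signSum
  rw [expect_sum_comm]
  refine sum_eq_zero fun v hv => ?_
  rw [expect_dotSign, if_neg]
  rintro rfl
  exact hR hv

lemma signSum_sq (R : Finset (Fin n → ZMod 2)) (w : Fin n → ZMod 2) :
    signSum R w ^ 2 = #R + ∑ p ∈ R.offDiag, dotSign w (p.1 + p.2) := by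
  rw [signSum, sq, sum_mul_sum, ← sum_product', ← diag_union_offDiag,
    sum_union (disjoint_diag_offDiag R)]
  congr 1
  · rw [sum_diag]
    simp [dotSign_mul_self]
  · exact sum_congr rfl fun p _ => (dotSign_add _ _ _).symm

lemma expect_signSum_sq (R : Finset (Fin n → ZMod 2)) : 𝔼 w, signSum R w ^ 2 = #R := by
  simp_rw [signSum_sq]
  rw [expect_add_distrib, Fintype.expect_const, expect_sum_comm, sum_eq_zero, add_zero]
  intro p hp
  rw [expect_dotSign, if_neg fun h => (mem_offDiag.1 hp).2.2 (add_eq_zero_iff_eq'.1 h)]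

lemma expect_signSum_pow_three (R : Finset (Fin n → ZMod 2)) :
    𝔼 w, signSum R w ^ 3 = ∑ a ∈ R, ∑ b ∈ R, ∑ c ∈ R, if a + b + c = 0 then (1 : ℝ) else 0 := by
  have h : ∀ w, signSum R w ^ 3 = ∑ a ∈ R, ∑ b ∈ R, ∑ c ∈ R, dotSign w (a + b + c) := by
    intro w
    rw [pow_succ, sq, signSum, sum_mul_sum, sum_mul]
    refine sum_congr rfl fun a _ => ?_
    rw [sum_mul]
    refine sum_congr rfl fun b _ => ?_
    rw [mul_sum]
    exact sum_congr rfl fun c _ => by rw [dotSign_add, dotSign_add]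
  simp_rw [h, expect_sum_comm, expect_dotSign]

lemma expect_signSum_pow_three_nonneg (R : Finset (Fin n → ZMod 2)) :
    0 ≤ 𝔼 w, signSum R w ^ 3 := by
  rw [expect_signSum_pow_three]
  exact sum_nonneg fun _ _ => sum_nonneg fun _ _ => sum_nonneg fun _ _ => by split_ifs <;> norm_num

lemma expect_signSum_pow_three_eq_zero {R : Finset (Fin n → ZMod 2)} (hR : 0 ∉ R)
    (h : ∀ T ⊆ R, #T = 3 → ∑ v ∈ T, v ≠ 0) : 𝔼 w, signSum R w ^ 3 = 0 := by
  rw [expect_signSum_pow_three]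
  refine sum_eq_zero fun a ha => sum_eq_zero fun b hb => sum_eq_zero fun c hc => if_neg fun h0 => ?_
  have hne : ∀ x ∈ R, x ≠ 0 := fun x hx h => hR (h ▸ hx)
  have hab : a ≠ b := by
    rintro rfl
    exact hne c hc (by simpa [add_self_eq_zero'] using h0)
  have hac : a ≠ c := by
    rintro rfl
    exact hne b hb (by simpa [add_right_comm _ b, add_self_eq_zero'] using h0)
  have hbc : b ≠ c := by
    rintro rfl
    exact hne a ha (by simpa [add_assoc, add_self_eq_zero'] using h0)
  refine h {a, b, c} (by simp [insert_subset_iff, ha, hb, hc]) (card_eq_three.2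
    ⟨a, b, c, hab, hac, hbc, rfl⟩) ?_
  rw [sum_insert (by simp [hab, hac]), sum_pair hbc, ← add_assoc, h0]

lemma expect_signSum_sq_sub_sq (R : Finset (Fin n → ZMod 2)) :
    𝔼 w, (signSum R w ^ 2 - #R) ^ 2 = ∑ p ∈ R.offDiag, ∑ q ∈ R.offDiag,
      if p.1 + p.2 + (q.1 + q.2) = 0 then (1 : ℝ) else 0 := by
  have h : ∀ w, (signSum R w ^ 2 - #R) ^ 2
      = ∑ p ∈ R.offDiag, ∑ q ∈ R.offDiag, dotSign w (p.1 + p.2 + (q.1 + q.2)) := by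
    intro w
    rw [signSum_sq, add_sub_cancel_left, sq, sum_mul_sum]
    exact sum_congr rfl fun p _ => sum_congr rfl fun q _ => (dotSign_add _ _ _).symm
  simp_rw [h, expect_sum_comm, expect_dotSign]

lemma sum_offDiag_eq_or_eq_swap (R : Finset (Fin n → ZMod 2)) :
    ∑ p ∈ R.offDiag, ∑ q ∈ R.offDiag, (if q = p ∨ q = p.swap then (1 : ℝ) else 0)
      = 2 * #R * (#R - 1) := by
  have h : ∀ p ∈ R.offDiag,
      ∑ q ∈ R.offDiag, (if q = p ∨ q = p.swap then (1 : ℝ) else 0) = 2 := by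
    intro p hp
    have hp' := mem_offDiag.1 hp
    have hne : p ≠ p.swap := fun h => hp'.2.2 (congrArg Prod.fst h)
    have hset : {q ∈ R.offDiag | q = p ∨ q = p.swap} = {p, p.swap} := by
      ext q
      simp only [mem_filter, mem_insert, mem_singleton]
      refine ⟨fun h => h.2, fun h => ⟨?_, h⟩⟩
      rcases h with rfl | rfl
      · exact hp
      · exact mem_offDiag.2 ⟨hp'.2.1, hp'.1, hp'.2.2.symm⟩
    rw [sum_boole, hset, card_pair hne]
    norm_num
  rw [sum_congr rfl h, sum_const, offDiag_card, nsmul_eq_mul,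
    Nat.cast_sub (Nat.le_mul_self _)]
  push_cast
  ring

lemma le_expect_signSum_sq_sub_sq (R : Finset (Fin n → ZMod 2)) :
    2 * #R * (#R - 1 : ℝ) ≤ 𝔼 w, (signSum R w ^ 2 - #R) ^ 2 := by
  rw [expect_signSum_sq_sub_sq, ← sum_offDiag_eq_or_eq_swap]
  refine sum_le_sum fun p _ => sum_le_sum fun q _ => ?_
  split_ifs with h h'
  · exact le_rfl
  · refine absurd ?_ h'
    rcases h with rfl | rfl
    · exact add_self_eq_zero' _
    · rw [Prod.fst_swap, Prod.snd_swap, add_comm p.2, add_self_eq_zero']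
  · norm_num
  · exact le_rfl

lemma expect_signSum_sq_sub_sq_le {R : Finset (Fin n → ZMod 2)}
    (h : ∀ T ⊆ R, #T = 4 → ∑ v ∈ T, v ≠ 0) :
    𝔼 w, (signSum R w ^ 2 - #R) ^ 2 ≤ 2 * #R * (#R - 1 : ℝ) := by
  rw [expect_signSum_sq_sub_sq, ← sum_offDiag_eq_or_eq_swap]
  refine sum_le_sum fun p hp => sum_le_sum fun q hq => ?_
  split_ifs with h0 h'
  · exact le_rfl
  · exfalso
    obtain ⟨a, b⟩ := p
    obtain ⟨c, d⟩ := q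
    simp only [mem_offDiag, Prod.mk.injEq, Prod.swap_prod_mk, not_or, not_and] at hp hq h' h0
    have h1 : a + b = c + d := add_eq_zero_iff_eq'.1 h0
    have hac : a ≠ c := by
      rintro rfl
      exact h'.1 rfl (add_left_cancel h1).symm
    have hbd : b ≠ d := by
      rintro rfl
      exact hac (add_right_cancel h1)
    have had : a ≠ d := by
      rintro rfl
      rw [add_comm c] at h1
      exact h'.2 (add_left_cancel h1).symm rfl
    have hbc : b ≠ c := by
      rintro rfl
      rw [add_comm a] at h1
      exact had (add_left_cancel h1)
    refine h {a, b, c, d} (by simp [insert_subset_iff, hp, hq]) ?_ ?_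
    · rw [card_insert_of_notMem (by simp [hp.2.2, hac, had]),
        card_insert_of_notMem (by simp [hbc, hbd]), card_pair hq.2.2]
    · rw [sum_insert (by simp [hp.2.2, hac, had]), sum_insert (by simp [hbc, hbd]),
        sum_pair hq.2.2, ← add_assoc, h0]
  · norm_num
  · exact le_rfl

end Cuts

section CutWeights

variable {n : ℕ}

/-- The average over `w` of `g (R ∩ cut w)`, multiplied by the parity sign of `R`. -/
noncomputable def cutMean (g : Finset (Fin n → ZMod 2) → ℝ) (R : Finset (Fin n → ZMod 2)) : ℝ :=
  𝔼 w, (-1) ^ #R * g (R ∩ cut w)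

/-- `R` is either small or a Schur triple. -/
def IsTight (R : Finset (Fin n → ZMod 2)) : Prop :=
  0 ∉ R ∧ (#R ≤ 2 ∨ #R = 3 ∧ ∑ v ∈ R, v = 0)

lemma le_cutMean_of_signSum_poly_le {R : Finset (Fin n → ZMod 2)} (hR : 0 ∉ R)
    (g : Finset (Fin n → ZMod 2) → ℝ) (a b c d e : ℝ)
    (h : ∀ w, a + b * signSum R w + c * (signSum R w ^ 2 - #R) + d * signSum R w ^ 3
      + e * (signSum R w ^ 2 - #R) ^ 2 ≤ (-1) ^ #R * g (R ∩ cut w)) :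
    a + d * 𝔼 w, signSum R w ^ 3 + e * 𝔼 w, (signSum R w ^ 2 - #R) ^ 2 ≤ cutMean g R := by
  refine le_trans (le_of_eq ?_) (expect_le_expect fun w _ => h w)
  simp only [expect_add_distrib, ← mul_expect, expect_sub_distrib, Fintype.expect_const,
    expect_signSum hR, expect_signSum_sq]
  ring

/-- Weights certifying the upper bound `1 / 8`. -/
noncomputable def cutWeight (A : Finset (Fin n → ZMod 2)) : ℝ :=
  if #A = 0 then 1 else if #A = 1 then -5 / 7 else if #A = 2 then -1 / 7
  else if #A = 3 then 1 / 9 else if #A = 4 ∧ ∑ v ∈ A, v = 0 then -1 / 28 else 0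

lemma cutWeight_of_card_eq_four {A : Finset (Fin n → ZMod 2)} (h : #A = 4) :
    -1 / 28 ≤ cutWeight A ∧ cutWeight A ≤ 0 := by
  simp only [cutWeight, h]
  split_ifs <;> norm_num at *

lemma cutWeight_of_five_le_card {A : Finset (Fin n → ZMod 2)} (h : 5 ≤ #A) : cutWeight A = 0 := by
  simp only [cutWeight, show #A ≠ 0 by omega, show #A ≠ 1 by omega, show #A ≠ 2 by omega,
    show #A ≠ 3 by omega, show #A ≠ 4 by omega, if_false, false_and]

lemma cutWeight_le {A : Finset (Fin n → ZMod 2)} (h : #A ≠ 0) :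
    cutWeight A ≤ if #A = 3 then 1 / 9 else 0 := by
  unfold cutWeight; split_ifs <;> first | contradiction | norm_num

lemma le_cutMean_of_odd {R : Finset (Fin n → ZMod 2)} (hR : 0 ∉ R) (hodd : Odd #R)
    (h9 : 9 ≤ #R) : -1 / 10 ≤ cutMean cutWeight R := by
  have hN : (9 : ℝ) ≤ #R := by exact_mod_cast h9
  have key := le_cutMean_of_signSum_poly_le hR cutWeight
    (-1 / (#R + 1)) (-2 / (#R + 1) ^ 2) (-1 / (#R + 1) ^ 2) 0 0 (fun w => by
      have hi := signSum_eq R w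
      have hpoly : -1 / (#R + 1) + -2 / (#R + 1) ^ 2 * signSum R w
          + -1 / (#R + 1) ^ 2 * (signSum R w ^ 2 - #R) + 0 * signSum R w ^ 3
          + 0 * (signSum R w ^ 2 - #R) ^ 2 = - ((signSum R w + 1) ^ 2 / (#R + 1) ^ 2) := by
        field_simp
        ring
      rw [hpoly, hodd.neg_one_pow, neg_one_mul, neg_le_neg_iff]
      rcases eq_or_ne #(R ∩ cut w) 0 with h0 | h0
      · rw [hi, h0, le_div_iff₀ (by positivity)]
        simp [cutWeight, h0]
      · refine (cutWeight_le h0).trans ?_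
        split_ifs with h3
        · rw [hi, h3, le_div_iff₀ (by positivity)]
          push_cast
          nlinarith
        · positivity)
  refine le_trans ?_ key
  rw [zero_mul, zero_mul, add_zero, add_zero, div_le_div_iff₀ (by norm_num) (by linarith)]
  linarith

lemma le_cutMean_of_even {R : Finset (Fin n → ZMod 2)} (hR : 0 ∉ R) (heven : Even #R)
    (h8 : 8 ≤ #R) : -15 / 112 ≤ cutMean cutWeight R := by
  have hN : (8 : ℝ) ≤ #R := by exact_mod_cast h8
  have key := le_cutMean_of_signSum_poly_le hR cutWeight
    (-20 / (7 * #R ^ 2) * (#R / 4 + 1)) (-20 / (7 * #R ^ 2)) (-5 / (7 * #R ^ 2)) 0 0 (fun w => by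
      have hi := signSum_eq R w
      have hpoly : -20 / (7 * #R ^ 2) * (#R / 4 + 1) + -20 / (7 * #R ^ 2) * signSum R w
          + -5 / (7 * #R ^ 2) * (signSum R w ^ 2 - #R) + 0 * signSum R w ^ 3
          + 0 * (signSum R w ^ 2 - #R) ^ 2
          = - (5 * (signSum R w + 2) ^ 2 / (7 * #R ^ 2)) := by
        field_simp
        ring
      rw [hpoly, heven.neg_one_pow, one_mul, neg_le, hi]
      rcases lt_or_ge #(R ∩ cut w) 5 with h5 | h5
      · obtain ⟨i, hi⟩ : ∃ i, i = #(R ∩ cut w) := ⟨_, rfl⟩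
        rw [← hi] at h5 ⊢
        rw [le_div_iff₀ (by positivity)]
        interval_cases i
        · simp only [cutWeight, ← hi]
          norm_num
          nlinarith
        · simp only [cutWeight, ← hi]
          norm_num
          nlinarith
        · simp only [cutWeight, ← hi]
          norm_num
          nlinarith
        · simp only [cutWeight, ← hi]
          norm_num
          nlinarith
        · have := (cutWeight_of_card_eq_four hi.symm).1
          push_cast
          nlinarith
      · rw [cutWeight_of_five_le_card h5, neg_zero]
        positivity)
  refine le_trans ?_ key
  rw [zero_mul, zero_mul, add_zero, add_zero, div_mul_eq_mul_div,
    div_le_div_iff₀ (by norm_num) (by positivity)]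
  nlinarith

lemma le_cutMean_of_card_eq_seven {R : Finset (Fin n → ZMod 2)} (hR : 0 ∉ R) (h7 : #R = 7) :
    -11 / 81 ≤ cutMean cutWeight R := by
  have key := le_cutMean_of_signSum_poly_le hR cutWeight
    (-11 / 81) (-4 / 81) (-1 / 81) 0 0 (fun w => by
      have hi := signSum_eq R w
      rw [h7] at hi ⊢
      rcases eq_or_ne #(R ∩ cut w) 0 with h0 | h0
      · rw [hi, h0]
        simp only [cutWeight, h0]
        norm_num
      · have := cutWeight_le h0
        split_ifs at this with h3
        · rw [hi, h3]
          push_cast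
          linarith
        · push_cast
          nlinarith [sq_nonneg (signSum R w + 2)])
  refine le_trans ?_ key
  norm_num

lemma le_cutMean_of_card_eq_six {R : Finset (Fin n → ZMod 2)} (hR : 0 ∉ R) (h6 : #R = 6) :
    -89 / 672 ≤ cutMean cutWeight R := by
  have key := le_cutMean_of_signSum_poly_le hR cutWeight
    (-899 / 4032) (-19 / 432) (-47 / 1008) 0 (73 / 48384) (fun w => by
      have hi := signSum_eq R w
      have hle : #(R ∩ cut w) ≤ 6 := h6 ▸ card_le_card inter_subset_left
      rw [h6] at hi ⊢
      rw [hi]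
      obtain ⟨i, hi⟩ : ∃ i, i = #(R ∩ cut w) := ⟨_, rfl⟩
      rw [← hi] at hle ⊢
      have := @cutWeight_of_card_eq_four _ (R ∩ cut w)
      interval_cases i
      iterate 4
        simp only [cutWeight, ← hi]
        norm_num
      · have := (this hi.symm).1
        norm_num at *
        linarith
      iterate 2
        rw [cutWeight_of_five_le_card (hi ▸ by norm_num)]
        norm_num)
  have h4 := le_expect_signSum_sq_sub_sq R
  rw [h6] at h4 key
  norm_num at h4
  refine le_trans ?_ key
  push_cast
  linarith

lemma le_cutMean_of_card_eq_five {R : Finset (Fin n → ZMod 2)} (hR : 0 ∉ R) (h5 : #R = 5)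
    (h : ∀ T ⊆ R, #T = 4 → ∑ v ∈ T, v ≠ 0) : 17 / 1008 ≤ cutMean cutWeight R := by
  have key := le_cutMean_of_signSum_poly_le hR cutWeight
    (443 / 1512) (5 / 42) (11 / 252) 0 (-167 / 24192) (fun w => by
      have hi := signSum_eq R w
      have hle : #(R ∩ cut w) ≤ 5 := h5 ▸ card_le_card inter_subset_left
      rw [h5] at hi ⊢
      rw [hi]
      obtain ⟨i, hi⟩ : ∃ i, i = #(R ∩ cut w) := ⟨_, rfl⟩
      rw [← hi] at hle ⊢
      interval_cases i
      iterate 4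
        simp only [cutWeight, ← hi]
        norm_num
      · have := (cutWeight_of_card_eq_four hi.symm).2
        norm_num at *
        linarith
      · rw [cutWeight_of_five_le_card (hi ▸ by norm_num)]
        norm_num)
  have h4 := expect_signSum_sq_sub_sq_le h
  rw [h5] at h4 key
  norm_num at h4
  refine le_trans ?_ key
  push_cast
  linarith

lemma le_cutMean_of_card_eq_four {R : Finset (Fin n → ZMod 2)} (hR : 0 ∉ R) (h4 : #R = 4)
    (h : ∑ v ∈ R, v ≠ 0) : -143 / 1008 ≤ cutMean cutWeight R := by
  have key := le_cutMean_of_signSum_poly_le hR cutWeight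
    (-19 / 63) (-479 / 1512) (-79 / 6048) (167 / 6048) (23 / 3456) (fun w => by
      have hi := signSum_eq R w
      have hle : #(R ∩ cut w) ≤ 4 := h4 ▸ card_le_card inter_subset_left
      rw [h4] at hi ⊢
      rw [hi]
      obtain ⟨i, hi⟩ : ∃ i, i = #(R ∩ cut w) := ⟨_, rfl⟩
      rw [← hi] at hle ⊢
      interval_cases i
      iterate 4
        simp only [cutWeight, ← hi]
        norm_num
      · have hsum : cutWeight (R ∩ cut w) = 0 := by
          have hR' : R ∩ cut w = R := eq_of_subset_of_card_le inter_subset_left (by omega)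
          rw [hR']
          simp [cutWeight, h4, h]
        rw [hsum]
        norm_num)
  have hm3 := expect_signSum_pow_three_nonneg R
  have hm4 := le_expect_signSum_sq_sub_sq R
  rw [h4] at hm4 key
  norm_num at hm4
  refine le_trans ?_ key
  push_cast
  linarith

lemma even_card_inter_cut {R : Finset (Fin n → ZMod 2)} (h : ∑ v ∈ R, v = 0)
    (w : Fin n → ZMod 2) : Even #(R ∩ cut w) := by
  have := dotSign_sum_eq_neg_one_pow w R
  rw [h, dotSign_zero] at this
  exact (neg_one_pow_eq_one_iff_even (by norm_num)).1 this.symm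

lemma le_cutMean_of_card_eq_four_of_sum_eq_zero {R : Finset (Fin n → ZMod 2)} (hR : 0 ∉ R)
    (h4 : #R = 4) (h : ∑ v ∈ R, v = 0) : 3 / 224 ≤ cutMean cutWeight R := by
  have key := le_cutMean_of_signSum_poly_le hR cutWeight
    (3 / 224) (29 / 224) (5 / 128) 0 0 (fun w => by
      have hi := signSum_eq R w
      have hle : #(R ∩ cut w) ≤ 4 := h4 ▸ card_le_card inter_subset_left
      have heven := even_card_inter_cut h w
      rw [h4] at hi ⊢
      rw [hi]
      obtain ⟨i, hi⟩ : ∃ i, i = #(R ∩ cut w) := ⟨_, rfl⟩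
      rw [← hi] at hle heven ⊢
      interval_cases i
      · simp only [cutWeight, ← hi]
        norm_num
      · exact absurd heven (by decide)
      · simp only [cutWeight, ← hi]
        norm_num
      · exact absurd heven (by decide)
      · have := (cutWeight_of_card_eq_four hi.symm).1
        norm_num at *
        linarith)
  linarith

lemma le_cutMean_of_card_eq_three {R : Finset (Fin n → ZMod 2)} (hR : 0 ∉ R) (h3 : #R = 3)
    (h : ∑ v ∈ R, v ≠ 0) : 23 / 126 ≤ cutMean cutWeight R := by
  have key := le_cutMean_of_signSum_poly_le hR cutWeight
    (23 / 126) (257 / 756) (-31 / 252) (-41 / 756) 0 (fun w => by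
      have hi := signSum_eq R w
      have hle : #(R ∩ cut w) ≤ 3 := h3 ▸ card_le_card inter_subset_left
      rw [h3] at hi ⊢
      rw [hi]
      obtain ⟨i, hi⟩ : ∃ i, i = #(R ∩ cut w) := ⟨_, rfl⟩
      rw [← hi] at hle ⊢
      interval_cases i
      iterate 4
        simp only [cutWeight, ← hi]
        norm_num)
  have hm3 : 𝔼 w, signSum R w ^ 3 = 0 := by
    refine expect_signSum_pow_three_eq_zero hR fun T hT hT3 => ?_
    rwa [eq_of_subset_of_card_le hT (by omega)]
  rw [hm3] at key
  linarith

lemma le_cutMean_insert {Q : Finset (Fin n → ZMod 2)} {v : Fin n → ZMod 2} (hQ : 0 ∉ Q)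
    (hv : v ≠ 0) (hvQ : v ∉ Q) (h4 : #Q = 4) (h : ∑ v ∈ Q, v = 0) :
    -283 / 2016 ≤ cutMean cutWeight (insert v Q) := by
  have hcross : 𝔼 w, dotSign w v * signSum Q w = 0 := by
    simp_rw [signSum, mul_sum, ← dotSign_add]
    rw [expect_sum_comm]
    refine sum_eq_zero fun q hq => ?_
    rw [expect_dotSign, if_neg]
    rw [add_eq_zero_iff_eq']
    rintro rfl
    exact hvQ hq
  have hpt : ∀ w, 1 / 63 - 79 / 504 * signSum Q w - 5 / 128 * signSum Q w ^ 2
      + 8 / 63 * dotSign w v + 55 / 2016 * (dotSign w v * signSum Q w)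
      ≤ (-1) ^ #(insert v Q) * cutWeight (insert v Q ∩ cut w) := by
    intro w
    have hi := signSum_eq Q w
    have hle : #(Q ∩ cut w) ≤ 4 := h4 ▸ card_le_card inter_subset_left
    have heven := even_card_inter_cut h w
    rw [card_insert_of_notMem hvQ, h4]
    rw [h4] at hi
    rw [hi]
    by_cases hvw : v ∈ cut w
    · rw [insert_inter_of_mem hvw]
      have hcard : #(insert v (Q ∩ cut w)) = #(Q ∩ cut w) + 1 :=
        card_insert_of_notMem fun h => hvQ (mem_inter.1 h).1
      obtain ⟨i, hi⟩ : ∃ i, i = #(Q ∩ cut w) := ⟨_, rfl⟩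
      rw [← hi] at hle heven hcard ⊢
      simp only [cutWeight, hcard, dotSign, hvw, if_true]
      interval_cases i
      · norm_num
      · exact absurd heven (by decide)
      · norm_num
      · exact absurd heven (by decide)
      · norm_num
    · rw [insert_inter_of_notMem hvw]
      obtain ⟨i, hi⟩ : ∃ i, i = #(Q ∩ cut w) := ⟨_, rfl⟩
      rw [← hi] at hle heven ⊢
      simp only [cutWeight, ← hi, dotSign, hvw, if_false]
      interval_cases i
      · norm_num
      · exact absurd heven (by decide)
      · norm_num
      · exact absurd heven (by decide)
      · have hQ' : Q ∩ cut w = Q := eq_of_subset_of_card_le inter_subset_left (by omega)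
        rw [hQ']
        norm_num [h]
  refine le_trans (le_of_eq ?_) (expect_le_expect fun w _ => hpt w)
  simp only [expect_add_distrib, expect_sub_distrib, ← mul_expect, Fintype.expect_const,
    expect_signSum hQ, expect_signSum_sq, hcross, expect_dotSign, hv, if_false, h4]
  norm_num

lemma le_cutMean_of_not_isTight {R : Finset (Fin n → ZMod 2)} (hR : 0 ∉ R) (h : ¬ IsTight R) :
    -143 / 1008 ≤ cutMean cutWeight R := by
  simp only [IsTight, hR, not_false_eq_true, true_and, not_or, not_and, not_le] at h
  obtain ⟨h2, h3⟩ := h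
  obtain hN | hN | hN | hN | hN | hN :
    #R = 3 ∨ #R = 4 ∨ #R = 5 ∨ #R = 6 ∨ #R = 7 ∨ 8 ≤ #R := by omega
  · linarith [le_cutMean_of_card_eq_three hR hN (h3 hN)]
  · by_cases hs : ∑ v ∈ R, v = 0
    · linarith [le_cutMean_of_card_eq_four_of_sum_eq_zero hR hN hs]
    · exact le_cutMean_of_card_eq_four hR hN hs
  · by_cases hs : ∀ T ⊆ R, #T = 4 → ∑ v ∈ T, v ≠ 0
    · linarith [le_cutMean_of_card_eq_five hR hN hs]
    · push Not at hs
      obtain ⟨Q, hQR, hQ4, hQ⟩ := hs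
      obtain ⟨v, hv⟩ := card_eq_one.1 (show #(R \ Q) = 1 by
        rw [card_sdiff_of_subset hQR]; omega)
      have hvR : v ∈ R \ Q := hv ▸ mem_singleton_self v
      have hins : R = insert v Q := by
        rw [← sdiff_union_of_subset hQR, hv]; rfl
      rw [mem_sdiff] at hvR
      have := le_cutMean_insert (fun h0 => hR (hQR h0)) (fun h0 => hR (h0 ▸ hvR.1)) hvR.2 hQ4 hQ
      rw [hins]
      linarith
  · linarith [le_cutMean_of_card_eq_six hR hN]
  · linarith [le_cutMean_of_card_eq_seven hR hN]
  · rcases Nat.even_or_odd #R with he | ho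
    · linarith [le_cutMean_of_even hR he hN]
    · have : 9 ≤ #R := by
        rcases ho with ⟨k, hk⟩
        omega
      linarith [le_cutMean_of_odd hR ho this]

/-- The cut average of a function of the size, on sets of size one or two. -/
lemma le_cutMean_of_card_le_two {R : Finset (Fin n → ZMod 2)} (hR : 0 ∉ R) (hne : R.Nonempty)
    (h2 : #R ≤ 2) {g : Finset (Fin n → ZMod 2) → ℝ} {c : ℕ → ℝ} (hg : ∀ A, #A ≤ 2 → g A = c #A)
    {m : ℝ} (hm1 : m ≤ -(c 0 + c 1) / 2) (hm2 : m ≤ (c 0 + 2 * c 1 + c 2) / 4) :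
    m ≤ cutMean g R := by
  have hle : ∀ w, #(R ∩ cut w) ≤ #R := fun w => card_le_card inter_subset_left
  have hpos := hne.card_pos
  obtain hN | hN : #R = 1 ∨ #R = 2 := by omega
  · have key := le_cutMean_of_signSum_poly_le hR g (-(c 0 + c 1) / 2) ((c 1 - c 0) / 2) 0 0 0
      (fun w => by
        rw [hg _ ((hle w).trans h2), signSum_eq]
        specialize hle w
        rw [hN] at hle ⊢
        obtain h | h : #(R ∩ cut w) = 0 ∨ #(R ∩ cut w) = 1 := by omega
        all_goals
          rw [h]
          push_cast
          linarith)
    linarith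
  · have key := le_cutMean_of_signSum_poly_le hR g ((c 0 + 2 * c 1 + c 2) / 4) ((c 0 - c 2) / 4)
      ((c 0 - 2 * c 1 + c 2) / 8) 0 0
      (fun w => by
        rw [hg _ ((hle w).trans h2), signSum_eq]
        specialize hle w
        rw [hN] at hle ⊢
        obtain h | h | h : #(R ∩ cut w) = 0 ∨ #(R ∩ cut w) = 1 ∨ #(R ∩ cut w) = 2 := by omega
        all_goals
          rw [h]
          push_cast
          linarith)
    linarith

/-- The cut average of a function of the size, on Schur triples. -/
lemma le_cutMean_of_card_eq_three_of_sum_eq_zero {R : Finset (Fin n → ZMod 2)} (hR : 0 ∉ R)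
    (h3 : #R = 3) (hsum : ∑ v ∈ R, v = 0) {g : Finset (Fin n → ZMod 2) → ℝ} {c : ℕ → ℝ}
    (hg : ∀ A, #A ≤ 2 → g A = c #A) : -(c 0 + 3 * c 2) / 4 ≤ cutMean g R := by
  have key := le_cutMean_of_signSum_poly_le hR g (-(c 0 + 3 * c 2) / 4) ((c 2 - c 0) / 4) 0 0 0
    (fun w => by
      have hle : #(R ∩ cut w) ≤ #R := card_le_card inter_subset_left
      have heven := even_card_inter_cut hsum w
      rw [signSum_eq]
      obtain h | h : #(R ∩ cut w) = 0 ∨ #(R ∩ cut w) = 2 := by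
        obtain ⟨k, hk⟩ := heven
        omega
      all_goals
        rw [hg _ (by omega), h, h3]
        push_cast
        linarith)
  linarith

lemma cutWeight_of_card_le_two {A : Finset (Fin n → ZMod 2)} (h : #A ≤ 2) :
    cutWeight A = if #A = 0 then 1 else if #A = 1 then -5 / 7 else -1 / 7 := by
  unfold cutWeight
  split_ifs <;> first | rfl | omega

lemma le_cutMean_of_isTight {R : Finset (Fin n → ZMod 2)} (hne : R.Nonempty) (h : IsTight R) :
    -1 / 7 ≤ cutMean cutWeight R := by
  obtain ⟨hR, h2 | ⟨h3, hs⟩⟩ := h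
  · exact le_cutMean_of_card_le_two hR hne h2
      (c := fun k => if k = 0 then 1 else if k = 1 then -5 / 7 else -1 / 7)
      (fun A hA => cutWeight_of_card_le_two hA) (by norm_num) (by norm_num)
  · refine le_trans ?_ (le_cutMean_of_card_eq_three_of_sum_eq_zero hR h3 hs
      (c := fun k => if k = 0 then 1 else if k = 1 then -5 / 7 else -1 / 7)
      (fun A hA => cutWeight_of_card_le_two hA))
    norm_num

lemma cutMean_empty (g : Finset (Fin n → ZMod 2) → ℝ) : cutMean g ∅ = g ∅ := by
  simp [cutMean]

/-- Weights detecting the mass on Schur triples. -/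
noncomputable def tripleWeight (A : Finset (Fin n → ZMod 2)) : ℝ :=
  if #A = 0 then 1 else if #A = 1 then -3 else if #A = 2 then 9 else 0

lemma tripleWeight_of_card_le_two {A : Finset (Fin n → ZMod 2)} (h : #A ≤ 2) :
    tripleWeight A = if #A = 0 then 1 else if #A = 1 then -3 else 9 := by
  unfold tripleWeight
  split_ifs <;> first | rfl | omega

lemma one_le_cutMean_tripleWeight {R : Finset (Fin n → ZMod 2)} (hR : 0 ∉ R) (h2 : #R ≤ 2) :
    1 ≤ cutMean tripleWeight R := by
  rcases R.eq_empty_or_nonempty with rfl | hne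
  · simp [cutMean_empty, tripleWeight]
  · exact le_cutMean_of_card_le_two hR hne h2
      (c := fun k => if k = 0 then 1 else if k = 1 then -3 else 9)
      (fun A hA => tripleWeight_of_card_le_two hA) (by norm_num) (by norm_num)

lemma le_cutMean_tripleWeight {R : Finset (Fin n → ZMod 2)} (hR : 0 ∉ R) (h3 : #R = 3)
    (hs : ∑ v ∈ R, v = 0) : -7 ≤ cutMean tripleWeight R := by
  refine le_trans ?_ (le_cutMean_of_card_eq_three_of_sum_eq_zero hR h3 hs
    (c := fun k => if k = 0 then 1 else if k = 1 then -3 else 9)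
    (fun A hA => tripleWeight_of_card_le_two hA))
  norm_num

lemma neg_nine_le_cutMean_tripleWeight {R : Finset (Fin n → ZMod 2)} (hR : 0 ∉ R) :
    -9 ≤ cutMean tripleWeight R := by
  have key := le_cutMean_of_signSum_poly_le hR tripleWeight (-9) 0 0 0 0 (fun w => by
    rcases neg_one_pow_eq_or ℝ #R with h | h <;> rw [h] <;> unfold tripleWeight <;>
      split_ifs <;> norm_num)
  linarith

end CutWeights

section Influence

open scoped Classical in
/-- The Fourier mass of `f` on the sets of `P` which meet `J`. -/
noncomputable def massMeeting {α : Type*} [DecidableEq α] [Fintype α] (P : Finset α → Prop)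
    (f : Finset α → ℝ) (J : Finset α) : ℝ :=
  ∑ R, if P R ∧ (R ∩ J).Nonempty then walshCoeff f R ^ 2 else 0

open scoped Classical in
/-- The Fourier mass of `f` outside `P`. -/
noncomputable def massOutside {α : Type*} [DecidableEq α] [Fintype α] (P : Finset α → Prop)
    (f : Finset α → ℝ) : ℝ :=
  ∑ R, if P R then 0 else walshCoeff f R ^ 2

variable {α : Type*} [DecidableEq α] [Fintype α] {P : Finset α → Prop} {f : Finset α → ℝ}

lemma massOutside_nonneg (P : Finset α → Prop) (f : Finset α → ℝ) : 0 ≤ massOutside P f :=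
  sum_nonneg fun R _ => by split_ifs <;> positivity

lemma walshCoeff_empty (f : Finset α → ℝ) : walshCoeff f ∅ = 𝔼 S, f S := by
  simp [walshCoeff]

lemma expect_eq_sum_walshCoeff_sq (hf : ∀ S, f S = 0 ∨ f S = 1) :
    𝔼 S, f S = ∑ R, walshCoeff f R ^ 2 := by
  simp_rw [sq]
  rw [← expect_mul_eq_sum_walshCoeff]
  refine expect_congr rfl fun S _ => ?_
  rcases hf S with h | h <;> simp [h]

lemma walshPart_empty_mem_Icc {β : Type*} [DecidableEq β] {f : Finset β → ℝ}
    (hf : ∀ S, f S = 0 ∨ f S = 1) (J S : Finset β) :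
    0 ≤ walshPart J ∅ f S ∧ walshPart J ∅ f S ≤ 1 := by
  have h0 : ∀ S, 0 ≤ f S ∧ f S ≤ 1 := fun S => by rcases hf S with h | h <;> norm_num [h]
  simp only [walshPart, walsh_empty_left, one_mul]
  refine ⟨div_nonneg (sum_nonneg fun B _ => (h0 _).1) (by positivity), ?_⟩
  rw [div_le_one (by positivity)]
  refine (sum_le_sum fun B _ => (h0 (S ∆ B)).2).trans ?_
  simp

lemma walshCoeff_sub (f g : Finset α → ℝ) (R : Finset α) :
    walshCoeff (fun S => f S - g S) R = walshCoeff f R - walshCoeff g R := by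
  simp only [walshCoeff, sub_mul, expect_sub_distrib]

lemma le_one_div_eight_add (x : ℝ) : x ≤ 1 / 8 + 54 * x ^ 4 := by
  have h : 1 / 8 + 54 * x ^ 4 - x = 54 * ((x - 1 / 6) ^ 2 * ((x + 1 / 6) ^ 2 + 1 / 18)) := by ring
  have : 0 ≤ 54 * ((x - 1 / 6) ^ 2 * ((x + 1 / 6) ^ 2 + 1 / 18)) := by positivity
  linarith

lemma massMeeting_nonneg (P : Finset α → Prop) (f : Finset α → ℝ) (J : Finset α) :
    0 ≤ massMeeting P f J :=
  sum_nonneg fun R _ => by split_ifs <;> positivity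

/-- If almost all of the spectrum of a Boolean function has degree at most three, then the mass
meeting a set of coordinates is either tiny or bounded below. -/
lemma massMeeting_le_or_le (hP : ∀ R, P R → #R ≤ 3) (hf : ∀ S, f S = 0 ∨ f S = 1)
    (J : Finset α) : massMeeting P f J ≤ massOutside P f ∨ 1 / 78732 ≤ massMeeting P f J := by
  classical
  by_contra! hcon
  obtain ⟨hW, hk⟩ := hcon
  set m := massMeeting P f J with hm
  set W := massOutside P f with hWdef
  have hW0 : 0 ≤ W := massOutside_nonneg P f
  let h : Finset α → ℝ := walshPart J ∅ f
  let D : Finset α → ℝ := fun S => f S - h S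
  have hcoeffh : ∀ R, walshCoeff h R = if R ∩ J = ∅ then walshCoeff f R else 0 := by
    intro R
    rw [walshCoeff_walshPart, empty_inter]
  have hcoeffD : ∀ R, walshCoeff D R = if R ∩ J = ∅ then 0 else walshCoeff f R := by
    intro R
    rw [walshCoeff_sub, hcoeffh]
    split_ifs <;> simp
  let c : Finset α → ℝ := fun R => if P R ∧ (R ∩ J).Nonempty then walshCoeff f R else 0
  have hc3 : ∀ R, 3 < #R → c R = 0 := fun R hR => if_neg fun hR' => by
    have := hP R hR'.1
    omega
  have hcsq : ∑ R ∈ (univ : Finset α).powerset, c R ^ 2 = m := by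
    rw [powerset_univ]
    refine sum_congr rfl fun R _ => ?_
    simp only [c]
    split_ifs <;> simp
  have hp4 := expect_walshPoly_pow_four_le univ 3 c hc3
  rw [hcsq] at hp4
  have hcoeffp : ∀ R, walshCoeff (walshPoly univ c) R = c R := by
    intro R
    have : walshPoly univ c = fun S => ∑ T, c T * walsh T S := by
      funext S
      simp [walshPoly]
    rw [this, walshCoeff_sum_mul_walsh]
  have hDp : 𝔼 S, D S * walshPoly univ c S = m := by
    rw [expect_mul_eq_sum_walshCoeff, ← hcsq, powerset_univ]
    refine sum_congr rfl fun R _ => ?_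
    rw [hcoeffp, hcoeffD]
    simp only [c, nonempty_iff_ne_empty]
    split_ifs <;> simp_all [sq]
  have hDabs : ∀ S, |D S| = f S + h S - 2 * (f S * h S) ∧ |D S| ≤ 1 := by
    intro S
    obtain ⟨h0, h1⟩ := walshPart_empty_mem_Icc hf J S
    simp only [D, h]
    rcases hf S with h | h <;> rw [h]
    · rw [abs_of_nonpos (by linarith)]
      constructor <;> linarith
    · rw [abs_of_nonneg (by linarith)]
      constructor <;> linarith
  have hEh : 𝔼 S, h S = 𝔼 S, f S := by
    rw [← walshCoeff_empty, hcoeffh, if_pos (empty_inter J), walshCoeff_empty]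
  have hEfh : 𝔼 S, f S * h S = ∑ R, if R ∩ J = ∅ then walshCoeff f R ^ 2 else 0 := by
    rw [expect_mul_eq_sum_walshCoeff]
    refine sum_congr rfl fun R _ => ?_
    rw [hcoeffh]
    split_ifs <;> simp [sq]
  have hEabs : 𝔼 S, |D S| ≤ 2 * (m + W) := by
    simp_rw [fun S => (hDabs S).1]
    rw [expect_sub_distrib, expect_add_distrib, ← mul_expect, hEh, hEfh,
      ← two_mul, ← mul_sub, expect_eq_sum_walshCoeff_sq hf, hm, hWdef, massMeeting, massOutside,
      ← sum_add_distrib, ← sum_sub_distrib]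
    refine mul_le_mul_of_nonneg_left (sum_le_sum fun R _ => ?_) zero_le_two
    have := sq_nonneg (walshCoeff f R)
    by_cases h1 : P R <;> by_cases h2 : R ∩ J = ∅ <;>
      simp [h1, h2, nonempty_iff_ne_empty, this]
  have hpt : ∀ S, D S * walshPoly univ c S ≤ 1 / 8 * |D S| + 54 * walshPoly univ c S ^ 4 := by
    intro S
    have h1 := le_one_div_eight_add |walshPoly univ c S|
    have h2 : |walshPoly univ c S| ^ 4 = walshPoly univ c S ^ 4 := by
      rw [← abs_pow, abs_of_nonneg (by positivity)]
    rw [h2] at h1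
    have h3 : D S * walshPoly univ c S ≤ |D S| * |walshPoly univ c S| := by
      rw [← abs_mul]
      exact le_abs_self _
    have h4 : 0 ≤ walshPoly univ c S ^ 4 := by positivity
    nlinarith [abs_nonneg (D S), (hDabs S).2, mul_le_mul_of_nonneg_left h1 (abs_nonneg (D S))]
  have hfin := expect_le_expect (s := univ) fun S _ => hpt S
  rw [hDp, expect_add_distrib, ← mul_expect, ← mul_expect] at hfin
  nlinarith

lemma massMeeting_union_le (P : Finset α → Prop) (f : Finset α → ℝ) (J K : Finset α) :
    massMeeting P f (J ∪ K) ≤ massMeeting P f J + massMeeting P f K := by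
  classical
  unfold massMeeting
  rw [← sum_add_distrib]
  refine sum_le_sum fun R _ => ?_
  simp only [inter_union_distrib_left, union_nonempty]
  have := sq_nonneg (walshCoeff f R)
  split_ifs <;> first | tauto | linarith

lemma massMeeting_le_massOutside (hP : ∀ R, P R → #R ≤ 3) (hf : ∀ S, f S = 0 ∨ f S = 1)
    (hW : 2 * massOutside P f < 1 / 78732) (J : Finset α)
    (hJ : ∀ i ∈ J, massMeeting P f {i} ≤ massOutside P f) :
    massMeeting P f J ≤ massOutside P f := by
  induction J using Finset.induction with
  | empty => simpa [massMeeting] using massOutside_nonneg P f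
  | insert i J _ ih =>
    refine (massMeeting_le_or_le hP hf _).resolve_right fun h => ?_
    have h1 := ih fun j hj => hJ j (mem_insert_of_mem hj)
    have h2 := hJ i (mem_insert_self i J)
    have h3 := massMeeting_union_le P f {i} J
    rw [insert_eq] at h
    linarith

lemma sum_massMeeting_singleton_le (hP : ∀ R, P R → #R ≤ 3) (hf : ∀ S, f S = 0 ∨ f S = 1) :
    ∑ i, massMeeting P f {i} ≤ 3 * 𝔼 S, f S := by
  classical
  unfold massMeeting
  rw [expect_eq_sum_walshCoeff_sq hf, sum_comm, mul_sum]
  refine sum_le_sum fun R _ => ?_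
  by_cases h : P R
  · have h1 : ∀ i, (R ∩ {i}).Nonempty ↔ i ∈ R := by
      intro i
      rw [inter_singleton]
      split_ifs with hi <;> simp [hi]
    simp only [h, h1, true_and]
    rw [sum_ite_mem, univ_inter, sum_const, nsmul_eq_mul]
    have : (#R : ℝ) ≤ 3 := by exact_mod_cast hP R h
    exact mul_le_mul_of_nonneg_right this (sq_nonneg _)
  · simp only [h, false_and, if_false, sum_const_zero]
    positivity

/-- All but boundedly many coordinates are met by a negligible part of the spectrum. -/
lemma exists_card_le_massMeeting_compl_le (hP : ∀ R, P R → #R ≤ 3) (hf : ∀ S, f S = 0 ∨ f S = 1)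
    (hμ : 𝔼 S, f S ≤ 1 / 8) (hW : 2 * massOutside P f < 1 / 78732) :
    ∃ K : Finset α, #K ≤ 30000 ∧ massMeeting P f Kᶜ ≤ massOutside P f := by
  classical
  refine ⟨({i | massOutside P f < massMeeting P f {i}} : Finset α), ?_, ?_⟩
  · set K : Finset α := {i | massOutside P f < massMeeting P f {i}} with hK
    have h1 : #K • (1 / 78732 : ℝ) ≤ ∑ i ∈ K, massMeeting P f {i} :=
      card_nsmul_le_sum _ _ _ fun i hi => (massMeeting_le_or_le hP hf _).resolve_left
        (not_le.2 (mem_filter.1 hi).2)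
    have h2 : ∑ i ∈ K, massMeeting P f {i} ≤ ∑ i, massMeeting P f {i} :=
      sum_le_univ_sum_of_nonneg fun i => massMeeting_nonneg P f {i}
    have h3 := sum_massMeeting_singleton_le hP hf
    rw [nsmul_eq_mul] at h1
    have : (#K : ℝ) ≤ 30000 := by linarith
    exact_mod_cast this
  · refine massMeeting_le_massOutside hP hf hW _ fun i hi => ?_
    simpa using hi

/-- Granularity: Fourier coefficients of a Boolean function on a maximal set of size three. -/
lemma eight_mul_abs_walshCoeff_le (hf : ∀ S, f S = 0 ∨ f S = 1) {t : Finset α} (ht : #t = 3)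
    (hPt : ∀ R, P R → t ⊆ R → R = t) :
    8 * |walshCoeff f t| ≤ (8 * |walshCoeff f t|) ^ 2 + 64 * massOutside P f := by
  classical
  let φ : Finset α → ℝ := walshPart t t f
  have hcoeff : ∀ R, walshCoeff φ R = if t ⊆ R then walshCoeff f R else 0 := by
    intro R
    rw [walshCoeff_walshPart, inter_self]
    simp only [inter_eq_right]
  have hz : ∀ S, ∃ z : ℤ, 8 * φ S = z := by
    intro S
    choose g hg using fun S => show ∃ z : ℤ, f S = z by
      rcases hf S with h | h
      · exact ⟨0, by simp [h]⟩
      · exact ⟨1, by simp [h]⟩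
    refine ⟨∑ B ∈ t.powerset, (-1) ^ #(t ∩ B) * g (S ∆ B), ?_⟩
    simp only [φ, walshPart, ht, hg, walsh]
    push_cast
    ring
  have habs : ∀ S, |φ S| ≤ 8 * φ S ^ 2 := by
    intro S
    obtain ⟨z, hz⟩ := hz S
    have h1 : |(z : ℝ)| ≤ (z : ℝ) ^ 2 := by
      have : |z| ≤ z ^ 2 := by
        rw [← Int.natCast_natAbs, ← Int.natAbs_sq]
        exact_mod_cast Nat.le_self_pow two_ne_zero _
      exact_mod_cast this
    rw [← hz, abs_mul, abs_of_pos (by norm_num : (0 : ℝ) < 8)] at h1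
    nlinarith
  have h1 : |walshCoeff f t| ≤ 𝔼 S, |φ S| := by
    have h2 : walshCoeff f t = 𝔼 S, φ S * walsh t S := by
      have := hcoeff t
      rw [if_pos subset_rfl] at this
      exact this.symm
    rw [h2]
    refine (abs_expect_le _ _).trans (le_of_eq ?_)
    simp only [abs_mul, abs_walsh, mul_one]
  have h2 : 𝔼 S, φ S ^ 2 ≤ walshCoeff f t ^ 2 + massOutside P f := by
    simp_rw [sq (φ _)]
    rw [expect_mul_eq_sum_walshCoeff, massOutside,
      ← Fintype.sum_ite_eq' t (fun R => walshCoeff f R ^ 2), ← sum_add_distrib]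
    refine sum_le_sum fun R _ => ?_
    rw [hcoeff, ← sq]
    have := sq_nonneg (walshCoeff f R)
    by_cases htR : t ⊆ R
    · by_cases hPR : P R
      · obtain rfl := hPt R hPR htR
        simp [hPR]
      · rw [if_pos htR, if_neg hPR]
        split_ifs <;> linarith
    · rw [if_neg htR]
      split_ifs <;> simp [this]
  have h3 := expect_le_expect (s := univ) fun S _ => habs S
  rw [← mul_expect] at h3
  rw [mul_pow, sq_abs]
  linarith

end Influence

section CutFree

variable {n : ℕ}

/-- A Boolean function on subsets of `Z_2^n`, not depending on whether `0` is in the subset, whose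
support contains no two sets agreeing only inside some cut. -/
structure IsCutFree (f : Finset (Fin n → ZMod 2) → ℝ) : Prop where
  eq_zero_or_eq_one : ∀ S, f S = 0 ∨ f S = 1
  walshCoeff_eq_zero : ∀ R, 0 ∈ R → walshCoeff f R = 0
  mul_eq_zero : ∀ w, ∀ B ⊆ cut w, ∀ S, f S * f (S ∆ Bᶜ) = 0

variable {f : Finset (Fin n → ZMod 2) → ℝ}

lemma walsh_compl {α : Type*} [Fintype α] [DecidableEq α] (R B : Finset α) :
    walsh R Bᶜ = (-1) ^ #R * walsh R B := by
  have h : Bᶜ = univ ∆ B := by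
    ext; simp [mem_symmDiff]
  rw [h, walsh_symmDiff, walsh, inter_univ]

lemma sum_walshCoeff_sq_mul_walsh (hf : IsCutFree f) {w : Fin n → ZMod 2}
    {B : Finset (Fin n → ZMod 2)} (hB : B ⊆ cut w) :
    ∑ R, (-1) ^ #R * walshCoeff f R ^ 2 * walsh R B = 0 := by
  have h : 𝔼 S, f S * f (S ∆ Bᶜ) = 0 := by
    simp_rw [hf.mul_eq_zero w B hB]
    exact expect_const_zero _
  rw [expect_mul_eq_sum_walshCoeff f (fun S => f (S ∆ Bᶜ))] at h
  rw [← h]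
  refine sum_congr rfl fun R _ => ?_
  rw [walshCoeff_comp_symmDiff, walsh_compl]
  ring

lemma sum_filter_inter_cut_eq (hf : IsCutFree f) (w : Fin n → ZMod 2)
    {A : Finset (Fin n → ZMod 2)} (hA : A ⊆ cut w) :
    ∑ R with R ∩ cut w = A, (-1) ^ #R * walshCoeff f R ^ 2 = 0 := by
  have h : ∑ B ∈ (cut w).powerset, walsh A B
      * ∑ R, (-1) ^ #R * walshCoeff f R ^ 2 * walsh R B = 0 :=
    sum_eq_zero fun B hB => by
      rw [sum_walshCoeff_sq_mul_walsh hf (mem_powerset.1 hB), mul_zero]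
  simp_rw [mul_sum] at h
  rw [sum_comm] at h
  simp_rw [mul_left_comm (walsh A _), ← mul_sum, sum_powerset_walsh_mul_walsh,
    inter_eq_left.2 hA, mul_ite, mul_zero] at h
  rw [← sum_filter, ← sum_mul] at h
  exact (mul_eq_zero.1 h).resolve_right (by positivity)

lemma sum_cutMean_mul (hf : IsCutFree f) (g : Finset (Fin n → ZMod 2) → ℝ) :
    ∑ R, cutMean g R * walshCoeff f R ^ 2 = 0 := by
  unfold cutMean
  simp_rw [expect_mul]
  rw [← expect_sum_comm]
  refine (expect_congr rfl fun w _ => ?_).trans (expect_const_zero univ)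
  rw [← sum_fiberwise_of_maps_to (t := (cut w).powerset) (g := fun R => R ∩ cut w)
    fun R _ => mem_powerset.2 inter_subset_right]
  refine sum_eq_zero fun A hA => ?_
  rw [← mul_zero (g A), ← sum_filter_inter_cut_eq hf w (mem_powerset.1 hA), mul_sum]
  refine sum_congr rfl fun R hR => ?_
  rw [(mem_filter.1 hR).2]
  ring

lemma massOutside_isTight_le (hf : IsCutFree f) :
    massOutside IsTight f ≤ 144 * ((𝔼 S, f S) * (1 - 8 * 𝔼 S, f S)) := by
  classical
  have hpt : ∀ R, (8 / 7 * if R = ∅ then walshCoeff f R ^ 2 else 0)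
      + -1 / 7 * walshCoeff f R ^ 2
      + 1 / 1008 * (if IsTight R then 0 else walshCoeff f R ^ 2)
      ≤ cutMean cutWeight R * walshCoeff f R ^ 2 := by
    intro R
    by_cases h0 : 0 ∈ R
    · simp [hf.walshCoeff_eq_zero R h0]
    · have hsq := sq_nonneg (walshCoeff f R)
      rcases R.eq_empty_or_nonempty with rfl | hne
      · rw [cutMean_empty]
        simp only [IsTight, cutWeight, card_empty]
        norm_num
        linarith
      · rw [if_neg hne.ne_empty]
        split_ifs with ht
        · linarith [mul_le_mul_of_nonneg_right (le_cutMean_of_isTight hne ht) hsq]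
        · linarith [mul_le_mul_of_nonneg_right (le_cutMean_of_not_isTight h0 ht) hsq]
  have h := sum_le_sum (s := univ) fun R _ => hpt R
  rw [sum_cutMean_mul hf, sum_add_distrib, sum_add_distrib, ← mul_sum, ← mul_sum, ← mul_sum,
    ← expect_eq_sum_walshCoeff_sq hf.eq_zero_or_eq_one, Fintype.sum_ite_eq', walshCoeff_empty,
    ← massOutside] at h
  nlinarith

lemma expect_le_one_div_eight (hf : IsCutFree f) : 𝔼 S, f S ≤ 1 / 8 := by
  have h1 := massOutside_isTight_le hf
  have h2 := massOutside_nonneg IsTight f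
  by_contra! h
  nlinarith

lemma le_sum_triples (hf : IsCutFree f) :
    𝔼 S, f S - 10 * massOutside IsTight f
      ≤ 8 * ∑ R with (0 ∉ R ∧ #R = 3 ∧ ∑ v ∈ R, v = 0), walshCoeff f R ^ 2 := by
  classical
  have hpt : ∀ R, walshCoeff f R ^ 2
      - 8 * (if 0 ∉ R ∧ #R = 3 ∧ ∑ v ∈ R, v = 0 then walshCoeff f R ^ 2 else 0)
      - 10 * (if IsTight R then 0 else walshCoeff f R ^ 2)
      ≤ cutMean tripleWeight R * walshCoeff f R ^ 2 := by
    intro R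
    by_cases h0 : 0 ∈ R
    · simp [hf.walshCoeff_eq_zero R h0]
    · have hsq := sq_nonneg (walshCoeff f R)
      by_cases ht : #R = 3 ∧ ∑ v ∈ R, v = 0
      · rw [if_pos ⟨h0, ht⟩, if_pos ⟨h0, Or.inr ht⟩]
        linarith [mul_le_mul_of_nonneg_right (le_cutMean_tripleWeight h0 ht.1 ht.2) hsq]
      · rw [if_neg fun h => ht h.2]
        split_ifs with h
        · linarith [mul_le_mul_of_nonneg_right
            (one_le_cutMean_tripleWeight h0 (h.2.resolve_right ht)) hsq]
        · linarith [mul_le_mul_of_nonneg_right (neg_nine_le_cutMean_tripleWeight h0) hsq]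
  have h := sum_le_sum (s := univ) fun R _ => hpt R
  rw [sum_cutMean_mul hf, sum_sub_distrib, sum_sub_distrib, ← mul_sum, ← mul_sum, ← sum_filter,
    ← expect_eq_sum_walshCoeff_sq hf.eq_zero_or_eq_one, ← massOutside] at h
  linarith

end CutFree

section Triples

variable {n : ℕ} {f : Finset (Fin n → ZMod 2) → ℝ}

lemma card_le_three_of_isTight {R : Finset (Fin n → ZMod 2)} (h : IsTight R) : #R ≤ 3 := by
  rcases h.2 with h | h <;> omega

lemma exists_mem_cut_of_ne {u v : Fin n → ZMod 2} (hu : u ≠ 0) (hv : v ≠ 0) (huv : u ≠ v) :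
    ∃ w, u ∈ cut w ∧ v ∈ cut w := by
  by_contra! hcon
  have hpt : ∀ w, (1 - dotSign w u) * (1 - dotSign w v) = 0 := by
    intro w
    by_cases h : u ∈ cut w
    · simp [dotSign, hcon w h]
    · simp [dotSign, h]
  have h1 : 𝔼 w : Fin n → ZMod 2, (1 - dotSign w u) * (1 - dotSign w v) = 0 := by
    simp_rw [hpt]
    exact expect_const_zero _
  have h2 : ∀ w, (1 - dotSign w u) * (1 - dotSign w v)
      = 1 - dotSign w u - dotSign w v + dotSign w (u + v) := fun w => by
    rw [dotSign_add]
    ring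
  simp_rw [h2, expect_add_distrib, expect_sub_distrib, expect_dotSign, hu, hv,
    add_eq_zero_iff_eq', huv, if_false, Fintype.expect_const] at h1
  norm_num at h1

lemma triple_sum_eq_zero {x y : Fin n → ZMod 2} (hx : x ≠ 0) (hy : y ≠ 0) (hxy : x ≠ y) :
    #{x, y, x + y} = 3 ∧ ∑ v ∈ {x, y, x + y}, v = 0 := by
  have h1 : x ≠ x + y := by simpa using hy
  have h2 : y ≠ x + y := by simpa using hx
  refine ⟨card_eq_three.2 ⟨_, _, _, hxy, h1, h2, rfl⟩, ?_⟩
  rw [sum_insert (by simp [hxy, h1]), sum_pair h2, ← add_assoc, add_self_eq_zero']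

lemma exists_eq_triple {t : Finset (Fin n → ZMod 2)} (h0 : 0 ∉ t) (h3 : #t = 3)
    (hs : ∑ v ∈ t, v = 0) : ∃ x y, x ≠ 0 ∧ y ≠ 0 ∧ x ≠ y ∧ t = {x, y, x + y} := by
  obtain ⟨x, y, z, hxy, hxz, hyz, rfl⟩ := card_eq_three.1 h3
  simp only [mem_insert, mem_singleton, not_or] at h0
  refine ⟨x, y, Ne.symm h0.1, Ne.symm h0.2.1, hxy, ?_⟩
  rw [sum_insert (by simp [hxy, hxz]), sum_pair hyz, ← add_assoc, add_eq_zero_iff_eq'] at hs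
  rw [hs]

/-- The Fourier coefficients at two elements of a Schur triple and at the triple agree, up to the
mass outside the tight sets. -/
lemma walshCoeff_triple_sq_le (hf : IsCutFree f) {u v : Fin n → ZMod 2} (hu : u ≠ 0) (hv : v ≠ 0)
    (huv : u ≠ v) : walshCoeff f {u, v, u + v} ^ 2
      ≤ walshCoeff f {u, v} ^ 2 + massOutside IsTight f := by
  classical
  obtain ⟨w, huw, hvw⟩ := exists_mem_cut_of_ne hu hv huv
  have hsum := sum_filter_inter_cut_eq hf w (A := {u, v})
    (by simp [insert_subset_iff, huw, hvw])
  have hcard : #{u, v} = 2 := card_pair huv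
  obtain ⟨ht3, hts⟩ := triple_sum_eq_zero hu hv huv
  have hne : ({u, v} : Finset (Fin n → ZMod 2)) ≠ {u, v, u + v} := by
    intro h
    rw [h] at hcard
    omega
  have hpt : ∀ R, (if R ∩ cut w = {u, v} then (-1) ^ #R * walshCoeff f R ^ 2 else 0)
      ≤ (if R = {u, v} then walshCoeff f R ^ 2 else 0)
        - (if R = {u, v, u + v} then walshCoeff f R ^ 2 else 0)
        + if IsTight R then 0 else walshCoeff f R ^ 2 := by
    intro R
    have hsq := sq_nonneg (walshCoeff f R)
    by_cases h1 : R = {u, v}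
    · have : ({u, v} : Finset (Fin n → ZMod 2)) ∩ cut w = {u, v} := by
        simp [huw, hvw]
      subst h1
      rw [if_pos this, if_pos rfl, if_neg hne, hcard]
      split_ifs <;> norm_num
      exact hsq
    by_cases h2 : R = {u, v, u + v}
    · have : ({u, v, u + v} : Finset (Fin n → ZMod 2)) ∩ cut w = {u, v} := by
        have : u + v ∉ cut w := by
          rw [mem_cut] at huw hvw ⊢
          rw [dotProduct_add, huw, hvw]
          decide
        rw [insert_inter_of_mem huw, insert_inter_of_mem hvw, singleton_inter_of_notMem this,
          insert_empty]
      subst h2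
      rw [if_pos this, if_neg h1, if_pos rfl, ht3]
      split_ifs <;> norm_num
      exact hsq
    rw [if_neg h1, if_neg h2, sub_zero, zero_add]
    split_ifs with h3 h4 h4
    · exfalso
      have hsub : {u, v} ⊆ R := h3 ▸ inter_subset_left
      rcases h4.2 with h5 | ⟨h5, h6⟩
      · exact h1 (eq_of_subset_of_card_le hsub (by omega)).symm
      · obtain ⟨z, hz⟩ := card_eq_one.1 (show #(R \ {u, v}) = 1 by
          rw [card_sdiff_of_subset hsub]; omega)
        have h7 := sum_sdiff (f := fun v => v) hsub
        rw [hz, h6, sum_singleton, sum_pair huv, add_eq_zero_iff_eq'] at h7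
        apply h2
        rw [← sdiff_union_of_subset hsub, hz, h7]
        ext
        simp
        tauto
    · rcases neg_one_pow_eq_or ℝ #R with h | h <;> rw [h] <;> linarith
    · exact le_rfl
    · exact hsq
  have h := sum_le_sum (s := univ) fun R _ => hpt R
  rw [← sum_filter, hsum, sum_add_distrib, sum_sub_distrib, Fintype.sum_ite_eq',
    Fintype.sum_ite_eq', ← massOutside] at h
  linarith

/-- If the mean is close to `1 / 8`, then some Schur triple carries a substantial part of the
spectrum. -/
lemma exists_triple_le_walshCoeff (hf : IsCutFree f) {ε : ℝ} (hε : ε ≤ 1 / 10 ^ 8)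
    (hμ : 1 / 8 - ε ≤ 𝔼 S, f S) : ∃ t, (0 ∉ t ∧ #t = 3 ∧ ∑ v ∈ t, v = 0) ∧
      1 / 10 ^ 8 ≤ |walshCoeff f t| := by
  classical
  have hW := massOutside_isTight_le hf
  have hμ8 := expect_le_one_div_eight hf
  have hW0 := massOutside_nonneg IsTight f
  have hWε : massOutside IsTight f ≤ 144 * ε := by nlinarith
  obtain ⟨K, hK, hKc⟩ := exists_card_le_massMeeting_compl_le
    (fun R hR => card_le_three_of_isTight hR) hf.eq_zero_or_eq_one hμ8 (by
      norm_num at hε ⊢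
      linarith)
  have h8 := le_sum_triples hf
  by_contra! hcon
  have hsplit : ∑ R with (0 ∉ R ∧ #R = 3 ∧ ∑ v ∈ R, v = 0), walshCoeff f R ^ 2
      ≤ massMeeting IsTight f Kᶜ + ∑ R ∈ K.powersetCard 3, (1 / 10 ^ 16 : ℝ) := by
    rw [massMeeting, sum_filter, ← univ_inter (K.powersetCard 3), ← sum_ite_mem,
      ← sum_add_distrib]
    refine sum_le_sum fun R _ => ?_
    by_cases ht : 0 ∉ R ∧ #R = 3 ∧ ∑ v ∈ R, v = 0
    · rw [if_pos ht]
      by_cases hR : (R ∩ Kᶜ).Nonempty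
      · rw [if_pos ⟨⟨ht.1, Or.inr ht.2⟩, hR⟩]
        have : (0 : ℝ) ≤ if R ∈ K.powersetCard 3 then 1 / 10 ^ 16 else 0 := by
          split_ifs <;> positivity
        linarith
      · have hRK : R ⊆ K := by
          rwa [not_nonempty_iff_eq_empty, ← sdiff_eq_inter_compl, sdiff_eq_empty_iff_subset] at hR
        rw [if_neg fun h => hR h.2, if_pos (mem_powersetCard.2 ⟨hRK, ht.2.1⟩), zero_add]
        have h1 := hcon R ht
        rw [← sq_abs]
        calc |walshCoeff f R| ^ 2 ≤ (1 / 10 ^ 8) ^ 2 := by gcongr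
          _ = 1 / 10 ^ 16 := by norm_num
    · rw [if_neg ht]
      refine add_nonneg ?_ ?_ <;> split_ifs <;> positivity
  have hchoose : (#(K.powersetCard 3) : ℝ) ≤ 30000 ^ 3 := by
    rw [card_powersetCard]
    exact_mod_cast (Nat.choose_le_pow _ _).trans (Nat.pow_le_pow_left hK 3)
  rw [sum_const, nsmul_eq_mul] at hsplit
  generalize (#(K.powersetCard 3) : ℝ) = N at hchoose hsplit
  norm_num at hchoose hε hsplit
  linarith

lemma abs_walshCoeff_le (hf : ∀ S, f S = 0 ∨ f S = 1) (R : Finset (Fin n → ZMod 2)) :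
    |walshCoeff f R| ≤ 𝔼 S, f S := by
  refine (abs_expect_le _ _).trans (le_of_eq ?_)
  refine expect_congr rfl fun S _ => ?_
  rw [abs_mul, abs_walsh, mul_one]
  rcases hf S with h | h <;> simp [h]

/-- Near-extremal functions have almost maximal Fourier coefficients on a Schur triple and on its
subsets of size two. -/
lemma exists_triple_forall_le_walshCoeff (hf : IsCutFree f) {ε : ℝ} (hε : ε ≤ 1 / 10 ^ 8)
    (hμ : 1 / 8 - ε ≤ 𝔼 S, f S) : ∃ x y, x ≠ 0 ∧ y ≠ 0 ∧ x ≠ y ∧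
      1 - 10 ^ 12 * ε ≤ 8 * |walshCoeff f {x, y, x + y}| ∧
      1 - 10 ^ 12 * ε ≤ 8 * |walshCoeff f {x, y}| ∧
      1 - 10 ^ 12 * ε ≤ 8 * |walshCoeff f {x, x + y}| := by
  obtain ⟨t, ht, hlarge⟩ := exists_triple_le_walshCoeff hf hε hμ
  obtain ⟨x, y, hx, hy, hxy, rfl⟩ := exists_eq_triple ht.1 ht.2.1 ht.2.2
  have hW := massOutside_isTight_le hf
  have hμ8 := expect_le_one_div_eight hf
  have hWε : massOutside IsTight f ≤ 144 * ε := by nlinarith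
  have hε0 : 0 ≤ ε := by linarith
  have habs := fun R => (abs_walshCoeff_le hf.eq_zero_or_eq_one R).trans hμ8
  have hgran := eight_mul_abs_walshCoeff_le (P := IsTight) hf.eq_zero_or_eq_one ht.2.1
    fun R hR hsub => (eq_of_subset_of_card_le hsub (by
      have := card_le_three_of_isTight hR
      omega)).symm
  have hpair : ∀ u v, u ≠ 0 → v ≠ 0 → u ≠ v → {u, v, u + v} = ({x, y, x + y} : Finset _) →
      1 - 10 ^ 12 * ε ≤ 8 * |walshCoeff f {u, v}| := by
    intro u v hu hv huv h
    have h1 := walshCoeff_triple_sq_le hf hu hv huv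
    rw [h, ← sq_abs, ← sq_abs (walshCoeff f {u, v})] at h1
    have h2 := habs {u, v}
    have h3 := abs_nonneg (walshCoeff f {u, v})
    norm_num at hlarge
    nlinarith [habs {x, y, x + y}]
  refine ⟨x, y, hx, hy, hxy, ?_, hpair x y hx hy hxy rfl, hpair x (x + y) hx ?_ ?_ ?_⟩
  · have h2 := habs {x, y, x + y}
    norm_num at hlarge
    nlinarith
  · rwa [Ne, add_eq_zero_iff_eq']
  · simpa using hy
  · rw [← add_assoc, add_self_eq_zero', zero_add, pair_comm]

end Triples

section Families

variable {n : ℕ} {F T : Finset (Finset (Fin n → ZMod 2))}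

/-- The indicator function of a family of sets of nonzero vectors, extended to all sets of vectors
by ignoring `0`. -/
noncomputable def famIndicator (F : Finset (Finset (Fin n → ZMod 2)))
    (S : Finset (Fin n → ZMod 2)) : ℝ :=
  if S.erase 0 ∈ F then 1 else 0

lemma famIndicator_eq_zero_or_eq_one (F : Finset (Finset (Fin n → ZMod 2)))
    (S : Finset (Fin n → ZMod 2)) : famIndicator F S = 0 ∨ famIndicator F S = 1 := by
  unfold famIndicator
  split_ifs <;> simp

lemma card_filter_erase_zero_mem (hF : ∀ S ∈ F, (0 : Fin n → ZMod 2) ∉ S) :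
    #{S : Finset (Fin n → ZMod 2) | S.erase 0 ∈ F} = 2 * #F := by
  rw [mul_comm, card_eq_sum_card_fiberwise (f := fun S => S.erase 0) (t := F)
    fun S hS => by simpa using hS, ← smul_eq_mul, ← sum_const]
  refine sum_congr rfl fun A hA => ?_
  have h0 := hF A hA
  have h : (insert 0 A : Finset (Fin n → ZMod 2)) ≠ A := fun h => h0 (h ▸ mem_insert_self 0 A)
  refine Eq.trans (congrArg card (?_ : _ = ({insert 0 A, A} : Finset _))) (card_pair h)
  ext S
  simp only [mem_filter, mem_univ, true_and, mem_insert, mem_singleton]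
  constructor
  · rintro ⟨_, rfl⟩
    by_cases hS : 0 ∈ S
    · exact Or.inl (insert_erase hS).symm
    · exact Or.inr (erase_eq_of_notMem hS).symm
  · rintro (rfl | rfl)
    · rw [erase_insert h0]
      exact ⟨hA, rfl⟩
    · rw [erase_eq_of_notMem h0]
      exact ⟨hA, rfl⟩

lemma expect_famIndicator (hF : ∀ S ∈ F, (0 : Fin n → ZMod 2) ∉ S) :
    𝔼 S, famIndicator F S = muFam n F := by
  unfold famIndicator muFam
  rw [Fintype.expect_eq_sum_div_card, sum_boole, card_filter_erase_zero_mem hF, Fintype.card_finset]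
  have h : 2 ^ n = 2 ^ n - 1 + 1 := (Nat.sub_add_cancel Nat.one_le_two_pow).symm
  have hcard : Fintype.card (Fin n → ZMod 2) = 2 ^ n - 1 + 1 := by
    rw [← h, Fintype.card_fun, ZMod.card, Fintype.card_fin]
  rw [hcard]
  generalize 2 ^ n - 1 = k
  push_cast
  rw [pow_succ', mul_div_mul_left _ _ two_ne_zero]

lemma famIndicator_symmDiff_singleton_zero (S : Finset (Fin n → ZMod 2)) :
    famIndicator F (S ∆ {0}) = famIndicator F S := by
  have h : (S ∆ {0}).erase 0 = S.erase 0 := by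
    ext v
    simp only [mem_erase, mem_symmDiff, mem_singleton]
    tauto
  rw [famIndicator, h, famIndicator]

lemma isCutFree_famIndicator (h : OddLDAgreeing n F) : IsCutFree (famIndicator F) where
  eq_zero_or_eq_one := famIndicator_eq_zero_or_eq_one F
  walshCoeff_eq_zero R hR := by
    have h1 := walshCoeff_comp_symmDiff (famIndicator F) {0} R
    simp_rw [famIndicator_symmDiff_singleton_zero] at h1
    rw [walsh, inter_singleton_of_mem hR, card_singleton] at h1
    linarith
  mul_eq_zero w B hB S := by
    by_contra hne
    simp only [famIndicator, mul_ite, mul_one, mul_zero, ite_eq_right_iff, not_forall] at hne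
    obtain ⟨h2, h1, -⟩ := hne
    obtain ⟨l, v, -, hv0, hv, hsum⟩ := h _ h1 _ h2
    have hcut : ∀ i, w ⬝ᵥ v i = 1 := by
      intro i
      refine mem_cut.1 (hB ?_)
      have := hv i
      simp only [mem_union, mem_sdiff, mem_erase, mem_symmDiff, mem_compl, hv0 i, ne_eq,
        not_false_eq_true, true_and] at this
      tauto
    have h3 : w ⬝ᵥ ∑ i, v i = 1 := by
      rw [dotProduct_sum, sum_congr rfl fun i _ => hcut i, sum_const, card_univ, Fintype.card_fin,
        nsmul_eq_mul, mul_one]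
      exact ZMod.natCast_eq_one_iff_odd.2 (odd_two_mul_add_one l)
    rw [hsum, dotProduct_zero] at h3
    exact zero_ne_one h3

/-- The family of sets of nonzero vectors which agree with `A` on `t`. -/
def junta (t A : Finset (Fin n → ZMod 2)) : Finset (Finset (Fin n → ZMod 2)) :=
  ((univ : Finset (Fin n → ZMod 2)).erase 0).powerset.filter fun S => S ∩ t = A ∩ t

lemma zero_notMem_of_mem_junta {t A S : Finset (Fin n → ZMod 2)} (hS : S ∈ junta t A) : 0 ∉ S :=
  fun h0 => notMem_erase _ _ (mem_powerset.1 (mem_filter.1 hS).1 h0)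

lemma schurJunta_junta {x y : Fin n → ZMod 2} (hx : x ≠ 0) (hy : y ≠ 0) (hxy : x ≠ y)
    (A : Finset (Fin n → ZMod 2)) : SchurJunta n (junta {x, y, x + y} A) :=
  ⟨x, y, A ∩ {x, y, x + y}, hx, hy, hxy, by rwa [Ne, add_eq_zero_iff_eq'], inter_subset_right, rfl⟩

lemma SchurJunta.exists_eq_junta (hF : SchurJunta n F) :
    ∃ t A, 0 ∉ t ∧ #t = 3 ∧ F = junta t A := by
  obtain ⟨x, y, R, hx, hy, hxy, hxy0, hR, rfl⟩ := hF
  refine ⟨{x, y, x + y}, R, ?_, (triple_sum_eq_zero hx hy hxy).1, ?_⟩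
  · simp [hx.symm, hy.symm, hxy0.symm]
  · rw [junta, inter_eq_left.2 hR]

lemma famIndicator_junta {t A : Finset (Fin n → ZMod 2)} (ht : 0 ∉ t)
    (S : Finset (Fin n → ZMod 2)) :
    famIndicator (junta t A) S = if S ∩ t = A ∩ t then 1 else 0 := by
  have h : S.erase 0 ∩ t = S ∩ t := by
    rw [erase_inter, erase_eq_of_notMem fun h => ht (mem_inter.1 h).2]
  have h2 : S.erase 0 ⊆ univ.erase 0 := erase_subset_erase _ (subset_univ S)
  simp only [famIndicator, junta, mem_filter, mem_powerset, h, h2, true_and]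

lemma muFam_junta {t A : Finset (Fin n → ZMod 2)} (ht : 0 ∉ t) (ht3 : #t = 3) :
    muFam n (junta t A) = 1 / 8 := by
  rw [← expect_famIndicator fun S => zero_notMem_of_mem_junta]
  have h : ∀ S : Finset (Fin n → ZMod 2), (if S ∩ t = A ∩ t then (1 : ℝ) else 0)
      = 1 / 8 * ∑ B ∈ t.powerset, walsh A B * walsh S B := by
    intro S
    rw [sum_powerset_walsh_mul_walsh, ht3]
    split_ifs <;> norm_num
  have h2 : ∀ B : Finset (Fin n → ZMod 2),
      𝔼 S : Finset (Fin n → ZMod 2), walsh S B = if B = ∅ then 1 else 0 := by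
    intro B
    simp_rw [← expect_walsh_mul_walsh, walsh_empty_left, one_mul, walsh_comm B]
  simp_rw [famIndicator_junta ht, h]
  rw [← mul_expect, expect_sum_comm]
  simp_rw [← mul_expect, h2]
  simp

lemma muFam_le_one (hF : ∀ S ∈ F, (0 : Fin n → ZMod 2) ∉ S) : muFam n F ≤ 1 := by
  rw [← expect_famIndicator hF, ← Fintype.expect_const (ι := Finset (Fin n → ZMod 2)) (1 : ℝ)]
  refine expect_le_expect fun S _ => ?_
  rcases famIndicator_eq_zero_or_eq_one F S with h | h <;> norm_num [h]

lemma zero_notMem_of_mem_symmDiff (hF : ∀ S ∈ F, (0 : Fin n → ZMod 2) ∉ S)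
    (hT : ∀ S ∈ T, (0 : Fin n → ZMod 2) ∉ S) : ∀ S ∈ (F \ T) ∪ (T \ F), 0 ∉ S := by
  intro S hS
  rcases mem_union.1 hS with h | h
  · exact hF S (mem_sdiff.1 h).1
  · exact hT S (mem_sdiff.1 h).1

lemma muFam_symmDiff (hF : ∀ S ∈ F, (0 : Fin n → ZMod 2) ∉ S)
    (hT : ∀ S ∈ T, (0 : Fin n → ZMod 2) ∉ S) :
    muFam n ((F \ T) ∪ (T \ F))
      = 2 * 𝔼 S, famIndicator F S * (1 - famIndicator T S) + muFam n T - muFam n F := by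
  rw [← expect_famIndicator hF, ← expect_famIndicator hT,
    ← expect_famIndicator (zero_notMem_of_mem_symmDiff hF hT), mul_expect, ← expect_add_distrib,
    ← expect_sub_distrib]
  refine expect_congr rfl fun S _ => ?_
  unfold famIndicator
  by_cases h1 : S.erase 0 ∈ F <;> by_cases h2 : S.erase 0 ∈ T <;> norm_num [h1, h2]

lemma exists_sign_expect_eq {α : Type*} [Fintype α] [DecidableEq α] (f : Finset α → ℝ)
    (R : Finset α) :
    ∃ η : ℝ, (η = 1 ∨ η = -1) ∧
      𝔼 S, f S * (1 - η * walsh R S) = 𝔼 S, f S - |walshCoeff f R| := by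
  have h : ∀ η : ℝ, 𝔼 S, f S * (1 - η * walsh R S) = 𝔼 S, f S - η * walshCoeff f R := by
    intro η
    rw [walshCoeff, mul_expect, ← expect_sub_distrib]
    exact expect_congr rfl fun S _ => by ring
  rcases abs_choice (walshCoeff f R) with h' | h'
  · exact ⟨1, Or.inl rfl, by rw [h, h', one_mul]⟩
  · exact ⟨-1, Or.inr rfl, by rw [h, h', neg_one_mul]⟩

lemma inter_triple_eq_of_walsh_eq {α : Type*} [DecidableEq α] {x y z : α} (hxy : x ≠ y)
    (hxz : x ≠ z) (hyz : y ≠ z) {S A : Finset α} (h1 : walsh {x, y, z} S = walsh {x, y, z} A)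
    (h2 : walsh {x, y} S = walsh {x, y} A) (h3 : walsh {x, z} S = walsh {x, z} A) :
    S ∩ {x, y, z} = A ∩ {x, y, z} := by
  simp only [walsh_eq_prod] at h1 h2 h3
  have htriple : ∀ g : α → ℝ, ∏ i ∈ {x, y, z}, g i = g x * (g y * g z) := fun g => by
    rw [prod_insert (by simp [hxy, hxz]), prod_pair hyz]
  rw [htriple, htriple] at h1
  rw [prod_pair hxy, prod_pair hxy] at h2
  rw [prod_pair hxz, prod_pair hxz] at h3
  have hs : ∀ i, (if i ∈ S then (-1 : ℝ) else 1) ≠ 0 := fun i => by split_ifs <;> norm_num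
  have hi : ∀ i, (if i ∈ S then (-1 : ℝ) else 1) = (if i ∈ A then -1 else 1) → (i ∈ S ↔ i ∈ A) := by
    intro i h
    grind
  rw [← mul_assoc, ← mul_assoc, ← h2] at h1
  have hz := mul_left_cancel₀ (mul_ne_zero (hs x) (hs y)) h1
  rw [← hz] at h3
  have hx := mul_right_cancel₀ (hs z) h3
  rw [← hx] at h2
  have hy := mul_left_cancel₀ (hs x) h2
  ext i
  simp only [mem_inter, mem_insert, mem_singleton]
  refine and_congr_left fun h => ?_
  rcases h with rfl | rfl | rfl
  · exact hi _ hx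
  · exact hi _ hy
  · exact hi _ hz

lemma exists_expect_inter_triple_ne_le {α : Type*} [Fintype α] [DecidableEq α]
    {f : Finset α → ℝ} (hf : ∀ S, f S = 0 ∨ f S = 1) {x y z : α} (hxy : x ≠ y) (hxz : x ≠ z)
    (hyz : y ≠ z) {δ : ℝ} (hδ : 3 / 2 * δ < 𝔼 S, f S)
    (h1 : 𝔼 S, f S - |walshCoeff f {x, y, z}| ≤ δ) (h2 : 𝔼 S, f S - |walshCoeff f {x, y}| ≤ δ)
    (h3 : 𝔼 S, f S - |walshCoeff f {x, z}| ≤ δ) :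
    ∃ A : Finset α,
      𝔼 S, f S * (1 - if S ∩ {x, y, z} = A ∩ {x, y, z} then 1 else 0) ≤ 3 / 2 * δ := by
  obtain ⟨η₁, hη₁, e1⟩ := exists_sign_expect_eq f {x, y, z}
  obtain ⟨η₂, hη₂, e2⟩ := exists_sign_expect_eq f {x, y}
  obtain ⟨η₃, hη₃, e3⟩ := exists_sign_expect_eq f {x, z}
  let L : Finset α → ℝ := fun S => (f S * (1 - η₁ * walsh {x, y, z} S)
    + f S * (1 - η₂ * walsh {x, y} S) + f S * (1 - η₃ * walsh {x, z} S)) / 2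
  have hL : 𝔼 S, L S ≤ 3 / 2 * δ := by
    simp only [L, ← expect_div, expect_add_distrib, e1, e2, e3]
    linarith
  have hterm : ∀ (R S : Finset α) (η : ℝ), (η = 1 ∨ η = -1) →
      0 ≤ f S * (1 - η * walsh R S) ∧ (walsh R S ≠ η → 2 * f S ≤ f S * (1 - η * walsh R S)) := by
    intro R S η hη
    rcases walsh_eq_one_or R S with hw | hw <;> rcases hη with rfl | rfl <;>
      rcases hf S with hS | hS <;> rw [hw, hS] <;> norm_num
  have hbad : ∀ S, 0 ≤ L S ∧
      (¬(walsh {x, y, z} S = η₁ ∧ walsh {x, y} S = η₂ ∧ walsh {x, z} S = η₃) → f S ≤ L S) := by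
    intro S
    have t1 := hterm {x, y, z} S η₁ hη₁
    have t2 := hterm {x, y} S η₂ hη₂
    have t3 := hterm {x, z} S η₃ hη₃
    refine ⟨by simp only [L]; linarith, fun hS => ?_⟩
    simp only [L]
    by_cases s1 : walsh {x, y, z} S = η₁
    · by_cases s2 : walsh {x, y} S = η₂
      · linarith [t3.2 fun s3 => hS ⟨s1, s2, s3⟩]
      · linarith [t2.2 s2]
    · linarith [t1.2 s1]
  obtain ⟨A, hA1, hA2, hA3⟩ : ∃ A, walsh {x, y, z} A = η₁ ∧ walsh {x, y} A = η₂
      ∧ walsh {x, z} A = η₃ := by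
    by_contra hcon
    have := expect_le_expect (s := univ) fun S _ => (hbad S).2 fun h => hcon ⟨S, h⟩
    linarith
  refine ⟨A, (expect_le_expect fun S _ => ?_).trans hL⟩
  split_ifs with hS
  · simpa using (hbad S).1
  · rw [sub_zero, mul_one]
    exact (hbad S).2 fun hcon => hS (inter_triple_eq_of_walsh_eq hxy hxz hyz
      (hcon.1.trans hA1.symm) (hcon.2.1.trans hA2.symm) (hcon.2.2.trans hA3.symm))

lemma exists_schurJunta_of_near (hF : ∀ S ∈ F, (0 : Fin n → ZMod 2) ∉ S) (h : OddLDAgreeing n F)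
    {ε : ℝ} (hε : ε ≤ 1 / 10 ^ 13) (hμ : 1 / 8 - ε ≤ muFam n F) :
    ∃ T, SchurJunta n T ∧ muFam n ((F \ T) ∪ (T \ F)) ≤ 10 ^ 12 * ε := by
  have hf := isCutFree_famIndicator h
  rw [← expect_famIndicator hF] at hμ
  have hμ8 := expect_le_one_div_eight hf
  obtain ⟨x, y, hx, hy, hxy, c1, c2, c3⟩ := exists_triple_forall_le_walshCoeff hf
    (hε.trans (by norm_num)) hμ
  have hxy0 : x + y ≠ 0 := by rwa [Ne, add_eq_zero_iff_eq']
  have ht0 : 0 ∉ ({x, y, x + y} : Finset (Fin n → ZMod 2)) := by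
    simp [hx.symm, hy.symm, hxy0.symm]
  obtain ⟨A, hA⟩ := exists_expect_inter_triple_ne_le (z := x + y) (δ := 10 ^ 12 / 8 * ε)
    hf.eq_zero_or_eq_one hxy (by simpa using hy) (by simpa using hx) (by linarith) (by linarith)
    (by linarith) (by linarith)
  refine ⟨junta {x, y, x + y} A, schurJunta_junta hx hy hxy A, ?_⟩
  rw [muFam_symmDiff hF fun S => zero_notMem_of_mem_junta,
    muFam_junta ht0 (triple_sum_eq_zero hx hy hxy).1, ← expect_famIndicator hF]
  simp_rw [famIndicator_junta ht0]
  linarith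

lemma exists_schurJunta (hn : 2 ≤ n) : ∃ T, SchurJunta n T := by
  have h : (⟨0, by omega⟩ : Fin n) ≠ ⟨1, by omega⟩ := by simp
  refine ⟨_, schurJunta_junta (x := Pi.single ⟨0, by omega⟩ 1) (y := Pi.single ⟨1, by omega⟩ 1)
    (by simp) (by simp) (fun h' => ?_) ∅⟩
  have := congrFun h' ⟨0, by omega⟩
  simp [h] at this

lemma SchurJunta.zero_notMem (hT : SchurJunta n T) : ∀ S ∈ T, 0 ∉ S := by
  obtain ⟨t, A, -, -, rfl⟩ := hT.exists_eq_junta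
  exact fun S => zero_notMem_of_mem_junta

lemma SchurJunta.muFam_eq (hT : SchurJunta n T) : muFam n T = 1 / 8 := by
  obtain ⟨t, A, h0, h3, rfl⟩ := hT.exists_eq_junta
  exact muFam_junta h0 h3

lemma schurJunta_of_muFam_eq (hF : ∀ S ∈ F, (0 : Fin n → ZMod 2) ∉ S) (h : OddLDAgreeing n F)
    (hμ : muFam n F = 1 / 8) : SchurJunta n F := by
  have hpow : (1 : ℝ) ≤ 2 ^ (2 ^ n - 1) := one_le_pow₀ one_le_two
  obtain ⟨T, hT, hle⟩ := exists_schurJunta_of_near hF h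
    (ε := 1 / (10 ^ 13 * 2 ^ (2 ^ n - 1)))
    (one_div_le_one_div_of_le (by positivity) (le_mul_of_one_le_right (by positivity) hpow))
    (by rw [hμ]; linarith [show (0 : ℝ) ≤ 1 / (10 ^ 13 * 2 ^ (2 ^ n - 1)) by positivity])
  have hcard : (#((F \ T) ∪ (T \ F)) : ℝ) < 1 := by
    rw [muFam, div_le_iff₀ (by positivity)] at hle
    refine hle.trans_lt ?_
    rw [mul_one_div, div_mul_eq_mul_div, mul_div_mul_right _ _ (by positivity)]
    norm_num
  have hempty : (F \ T) ∪ (T \ F) = ∅ := by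
    rw [← card_eq_zero]
    exact Nat.lt_one_iff.1 (by exact_mod_cast hcard)
  have hFT : F = T := by
    rw [union_eq_empty, sdiff_eq_empty_iff_subset, sdiff_eq_empty_iff_subset] at hempty
    exact subset_antisymm hempty.1 hempty.2
  exact hFT ▸ hT

end Families

end

theorem odd_LD_agreeing_bound_and_stability :
    (∀ (n : ℕ), 2 ≤ n →
      ∀ F : Finset (Finset (Fin n → ZMod 2)),
        (∀ S ∈ F, (0 : Fin n → ZMod 2) ∉ S) →
        OddLDAgreeing n F →
        muFam n F ≤ 1 / 8 ∧ (muFam n F = 1 / 8 ↔ SchurJunta n F)) ∧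
    (∃ c : ℝ, 0 < c ∧
      ∀ ε : ℝ, 0 < ε →
        ∀ (n : ℕ), 2 ≤ n →
          ∀ F : Finset (Finset (Fin n → ZMod 2)),
            (∀ S ∈ F, (0 : Fin n → ZMod 2) ∉ S) →
            OddLDAgreeing n F →
            muFam n F ≥ 1 / 8 - ε →
            ∃ T : Finset (Finset (Fin n → ZMod 2)), SchurJunta n T ∧
              muFam n ((F \ T) ∪ (T \ F)) ≤ c * ε) := by
  refine ⟨fun n _ F hF h => ⟨?_, schurJunta_of_muFam_eq hF h, SchurJunta.muFam_eq⟩,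
    10 ^ 13, by norm_num, fun ε hε n hn F hF h hμ => ?_⟩
  · rw [← expect_famIndicator hF]
    exact expect_le_one_div_eight (isCutFree_famIndicator h)
  · rcases le_or_gt ε (1 / 10 ^ 13) with hsmall | hlarge
    · obtain ⟨T, hT, hle⟩ := exists_schurJunta_of_near hF h hsmall hμ
      exact ⟨T, hT, hle.trans (by norm_num; linarith)⟩
    · obtain ⟨T, hT⟩ := exists_schurJunta hn
      refine ⟨T, hT, (muFam_le_one (zero_notMem_of_mem_symmDiff hF hT.zero_notMem)).trans ?_⟩
      rw [div_lt_iff₀ (by norm_num)] at hlarge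
      linarith
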